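/- Under the standard assumptions: (1) if H_a and H_b are any Kuratowski subgraphs of G avoiding a and b respectively, then b ∈ V(H_a) and a ∈ V(H_b); (2) ab is not an edge of G; (3) if H_a and H_b are any Kuratowski subgraphs of G avoiding a and b respectively, then E(G) ⊆ E(L) ∪ E(H_a) ∪ E(H_b); (4) no 2-cut of G[C ∪ {a,b}] that separates a from b induces an edge of G. -/

import Mathlib

open SimpleGraph

/-- The complete graph on five vertices. -/
def K5 : SimpleGraph (Fin 5) := ⊤

/-- The complete bipartite graph `K_{3,3}`. -/
def K33 : SimpleGraph (Fin 6) :=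
  SimpleGraph.fromRel (fun i j => i.val < 3 ∧ 3 ≤ j.val)

/-- `K_{3,3}` plus one extra edge joining two vertices in the same part. -/
def K33e : SimpleGraph (Fin 6) :=
  SimpleGraph.fromRel (fun i j => (i.val < 3 ∧ 3 ≤ j.val) ∨ (i.val = 0 ∧ j.val = 1))

/-- `H` is a minor of `G`, witnessed by a family of nonempty, connected,
pairwise disjoint branch sets together with edges between the branch sets of
adjacent vertices of `H`. -/
def SimpleGraph.IsMinorOf {W V : Type} (H : SimpleGraph W) (G : SimpleGraph V) : Prop :=
  ∃ f : W → Set V,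
    (∀ w, (G.induce (f w)).Connected) ∧
    (Pairwise fun w w' => Disjoint (f w) (f w')) ∧
    (∀ ⦃w w'⦄, H.Adj w w' → ∃ u ∈ f w, ∃ v ∈ f w', G.Adj u v)

/-- Planarity, via the Kuratowski–Wagner characterization: a (finite simple) graph is
planar iff it has no `K₅` minor and no `K_{3,3}` minor. -/
def IsPlanar {V : Type} (G : SimpleGraph V) : Prop :=
  ¬ K5.IsMinorOf G ∧ ¬ K33.IsMinorOf G

/-- A graph is apex if it is planar or some vertex deletion makes it planar. -/
def IsApex {V : Type} (G : SimpleGraph V) : Prop :=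
  IsPlanar G ∨ ∃ v : V, IsPlanar (G.induce {u | u ≠ v})

/-- `G` is an obstruction for the apex family: it is not apex, but every minor of it
that is not isomorphic to it is apex. -/
def IsApexObstruction {V : Type} (G : SimpleGraph V) : Prop :=
  ¬ IsApex G ∧
    ∀ (W : Type) (H : SimpleGraph W), H.IsMinorOf G → IsEmpty (H ≃g G) → IsApex H

/-- Subdivide the edge `uv` of `G`: the new vertex is `none`. -/
def subdivideEdge {V : Type} (G : SimpleGraph V) (u v : V) : SimpleGraph (Option V) :=
  SimpleGraph.fromRel (fun x y =>
    (∃ a b, x = some a ∧ y = some b ∧ G.Adj a b ∧ s(a, b) ≠ s(u, v)) ∨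
    (x = none ∧ (y = some u ∨ y = some v)))

/-- `IsSubdivision G H` : `H` is (isomorphic to) a graph obtained from `G` by repeatedly
subdividing edges. -/
inductive IsSubdivision : {V : Type} → SimpleGraph V → {W : Type} → SimpleGraph W → Prop
  | of_iso {V W : Type} {G : SimpleGraph V} {H : SimpleGraph W} :
      (G ≃g H) → IsSubdivision G H
  | step {V W U : Type} {G : SimpleGraph V} {H : SimpleGraph W} {u v : W}
      {H' : SimpleGraph U} :
      H.Adj u v → IsSubdivision G H → (subdivideEdge H u v ≃g H') → IsSubdivision G H'

/-- A Kuratowski subgraph of `G` is a subgraph that is a subdivision of `K₅` or `K_{3,3}`. -/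
def IsKuratowski {V : Type} {G : SimpleGraph V} (H : G.Subgraph) : Prop :=
  IsSubdivision K5 H.coe ∨ IsSubdivision K33 H.coe

/-- A Kuratowski witness for `v` is a Kuratowski subgraph of `G` avoiding `v`. -/
def IsKuratowskiWitness {V : Type} (G : SimpleGraph V) (v : V) (H : G.Subgraph) : Prop :=
  IsKuratowski H ∧ v ∉ H.verts

/-- A branch vertex of a (Kuratowski) subgraph: a vertex of degree at least 3 in it. -/
def IsBranchVertex {V : Type} {G : SimpleGraph V} (H : G.Subgraph) (x : V) : Prop :=
  x ∈ H.verts ∧ 3 ≤ (H.neighborSet x).ncard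

/-- The vertex connectivity of a finite graph: the largest `k` such that deleting any
fewer than `k` vertices leaves a connected graph. -/
noncomputable def vConn {V : Type} [Fintype V] (G : SimpleGraph V) : ℕ :=
  sSup {k : ℕ | ∀ s : Finset V, s.card < k → (G.induce ((↑s : Set V)ᶜ)).Connected}

/-- A 2-cut: a set of two vertices whose deletion disconnects the graph. -/
def IsTwoCut {V : Type} (G : SimpleGraph V) (S : Set V) : Prop :=
  S.ncard = 2 ∧ ¬ (G.induce Sᶜ).Preconnected

/-- `C` is (the vertex set of) a connected component of `G − S`. -/
def IsCompOf {V : Type} (G : SimpleGraph V) (S : Set V) (C : Set V) : Prop :=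
  C.Nonempty ∧ Disjoint C S ∧ (G.induce C).Connected ∧
    ∀ u ∈ C, ∀ v, v ∉ S → G.Adj u v → v ∈ C

/-- The augmented component `C⁺`: the subgraph induced by `C ∪ S` together with all
edges joining vertices of `S`. -/
def augment {V : Type} (G : SimpleGraph V) (S C : Set V) : SimpleGraph ↥(C ∪ S) :=
  SimpleGraph.fromRel (fun u v => G.Adj (u : V) (v : V) ∨ ((u : V) ∈ S ∧ (v : V) ∈ S))

/-- `C` is a heavy component for the 2-cut `{a,b}`: a component of `G − {a,b}` whose
augmentation contains Kuratowski witnesses for both `a` and `b`. -/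
def IsHeavyComp {V : Type} (G : SimpleGraph V) (a b : V) (C : Set V) : Prop :=
  IsCompOf G {a, b} C ∧
    (∃ Ha : G.Subgraph, IsKuratowskiWitness G a Ha ∧ Ha.verts ⊆ C ∪ {a, b}) ∧
    (∃ Hb : G.Subgraph, IsKuratowskiWitness G b Hb ∧ Hb.verts ⊆ C ∪ {a, b})

/-- `{a,b}` is a basic 2-cut with heavy component `C`: a 2-cut whose heavy-component
weight is minimum among all 2-cuts. -/
def IsBasic2Cut {V : Type} (G : SimpleGraph V) (a b : V) (C : Set V) : Prop :=
  IsTwoCut G {a, b} ∧ IsHeavyComp G a b C ∧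
    ∀ c d : V, ∀ D : Set V, IsTwoCut G {c, d} → IsHeavyComp G c d D → C.ncard ≤ D.ncard

/-- The subgraph of `G` induced by `A`, kept on the same vertex set (vertices outside `A`
become isolated). -/
def restrictTo {V : Type} (G : SimpleGraph V) (A : Set V) : SimpleGraph V :=
  SimpleGraph.fromRel (fun u v => G.Adj u v ∧ u ∈ A ∧ v ∈ A)

/-- Contract the edge `uv` of `G`, keeping the label `u` for the merged vertex
(`v` becomes isolated). -/
def contractEdge {V : Type} (G : SimpleGraph V) (u v : V) : SimpleGraph V :=
  SimpleGraph.fromRel (fun x y =>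
    x ≠ v ∧ y ≠ v ∧ (G.Adj x y ∨ (x = u ∧ G.Adj v y) ∨ (y = u ∧ G.Adj x v)))

/-- `T` separates `a` from `b` in `G`: `a, b ∉ T` and every walk from `a` to `b`
meets `T`. -/
def Separates {V : Type} (G : SimpleGraph V) (T : Set V) (a b : V) : Prop :=
  a ∉ T ∧ b ∉ T ∧ ∀ p : G.Walk a b, ∃ t ∈ T, t ∈ p.support

/-- Disjoint union of two graphs. -/
def disjUnion {V W : Type} (G : SimpleGraph V) (H : SimpleGraph W) : SimpleGraph (V ⊕ W) :=
  SimpleGraph.fromRel (fun x y =>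
    (∃ a b, x = Sum.inl a ∧ y = Sum.inl b ∧ G.Adj a b) ∨
    (∃ a b, x = Sum.inr a ∧ y = Sum.inr b ∧ H.Adj a b))

/-- The graph on `Fin n` with the given list of edges. -/
def graphOfList (n : ℕ) (l : List (ℕ × ℕ)) : SimpleGraph (Fin n) :=
  SimpleGraph.fromRel (fun i j => ((i : ℕ), (j : ℕ)) ∈ l)

/-- A graph is 2-connected: at least three vertices and no cut vertex. -/
def IsTwoConnectedGraph {U : Type} (H : SimpleGraph U) : Prop :=
  3 ≤ Nat.card U ∧ ∀ u : U, (H.induce {x | x ≠ u}).Connected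



/-- `S` is nonempty and induces a connected subgraph of `H`, phrased through sets closed
under adjacency. -/
def ConnectedIn {V : Type} (H : SimpleGraph V) (S : Set V) : Prop :=
  S.Nonempty ∧ ∀ T : Set V, (S ∩ T).Nonempty →
    (∀ u ∈ S, u ∈ T → ∀ v ∈ S, H.Adj u v → v ∈ T) → S ⊆ T

/-- `Q` has a minor model in `H` all of whose branch sets lie in `X`. -/
def HasModelIn {W V : Type} (Q : SimpleGraph W) (H : SimpleGraph V) (X : Set V) : Prop :=
  ∃ f : W → Set V,
    (∀ w, ConnectedIn H (f w)) ∧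
    (∀ w w', w ≠ w' → Disjoint (f w) (f w')) ∧
    (∀ w w', Q.Adj w w' → ∃ u ∈ f w, ∃ v ∈ f w', H.Adj u v) ∧
    ∀ w, f w ⊆ X

/-- The subgraph of `H` induced by `X` is not planar. -/
def NonplanarOn {V : Type} (H : SimpleGraph V) (X : Set V) : Prop :=
  HasModelIn K5 H X ∨ HasModelIn K33 H X

theorem connectedIn_iff {V : Type} (H : SimpleGraph V) (S : Set V) :
    ConnectedIn H S ↔ (H.induce S).Connected := by
  constructor
  · rintro ⟨⟨s, hs⟩, h⟩
    have : Nonempty S := ⟨⟨s, hs⟩⟩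
    refine ⟨fun x y => ?_⟩
    have key := h {v | ∃ hv : v ∈ S, (H.induce S).Reachable x ⟨v, hv⟩}
      ⟨x, x.2, x.2, SimpleGraph.Reachable.refl _⟩ (by
        rintro u hu ⟨_, hr⟩ v hv huv
        refine ⟨hv, hr.trans (SimpleGraph.Adj.reachable ?_)⟩
        exact huv)
    obtain ⟨_, hr⟩ := key y.2
    exact hr
  · intro h
    obtain ⟨s⟩ := h.nonempty
    refine ⟨⟨s, s.2⟩, ?_⟩
    rintro T ⟨t, htS, htT⟩ hT v hv
    obtain ⟨p⟩ := h.preconnected ⟨t, htS⟩ ⟨v, hv⟩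
    have aux : ∀ x y : S, (H.induce S).Walk x y → (x : V) ∈ T → (y : V) ∈ T := by
      intro x y p
      induction p with
      | nil => exact id
      | cons hadj _ ih => exact fun hx => ih (hT _ (Subtype.prop _) hx _ (Subtype.prop _) hadj)
    exact aux _ _ p htT

theorem hasModelIn_univ_iff {W V : Type} (Q : SimpleGraph W) (H : SimpleGraph V) :
    HasModelIn Q H Set.univ ↔ Q.IsMinorOf H := by
  constructor
  · rintro ⟨f, h1, h2, h3, _⟩
    exact ⟨f, fun w => (connectedIn_iff H _).1 (h1 w), fun w w' h => h2 w w' h,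
      fun w w' h => h3 w w' h⟩
  · rintro ⟨f, h1, h2, h3⟩
    exact ⟨f, fun w => (connectedIn_iff H _).2 (h1 w), fun w w' h => h2 h,
      fun w w' h => h3 h, fun w => Set.subset_univ _⟩

theorem isPlanar_iff {V : Type} (H : SimpleGraph V) :
    IsPlanar H ↔ ¬ NonplanarOn H Set.univ := by
  unfold IsPlanar NonplanarOn
  rw [hasModelIn_univ_iff, hasModelIn_univ_iff, not_or]

theorem ConnectedIn.singleton {V : Type} (H : SimpleGraph V) (v : V) : ConnectedIn H {v} := by
  refine ⟨⟨v, rfl⟩, ?_⟩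
  rintro T ⟨t, rfl, ht⟩ _ u rfl
  exact ht

theorem ConnectedIn.mono {V : Type} {H H' : SimpleGraph V} {S : Set V} (h : ConnectedIn H S)
    (hH : ∀ u ∈ S, ∀ v ∈ S, H.Adj u v → H'.Adj u v) : ConnectedIn H' S :=
  ⟨h.1, fun T hT hcl => h.2 T hT fun u hu hut v hv huv => hcl u hu hut v hv (hH u hu v hv huv)⟩

/-- Models pull back along contractions. -/
theorem HasModelIn.contract {W V V' : Type} {Q : SimpleGraph W} {H : SimpleGraph V}
    {H' : SimpleGraph V'} {X : Set V} {Y : Set V'} (h : HasModelIn Q H X) (φ : V → Set V')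
    (hconn : ∀ u ∈ X, ConnectedIn H' (φ u))
    (hdisj : ∀ u ∈ X, ∀ v ∈ X, u ≠ v → Disjoint (φ u) (φ v))
    (hadj : ∀ u ∈ X, ∀ v ∈ X, H.Adj u v → ∃ u' ∈ φ u, ∃ v' ∈ φ v, H'.Adj u' v')
    (hsub : ∀ u ∈ X, φ u ⊆ Y) : HasModelIn Q H' Y := by
  obtain ⟨f, h1, h2, h3, h4⟩ := h
  refine ⟨fun w => ⋃ u ∈ f w, φ u, ?_, ?_, ?_, ?_⟩
  · intro w
    constructor
    · obtain ⟨u, hu⟩ := (h1 w).1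
      obtain ⟨x, hx⟩ := (hconn u (h4 w hu)).1
      exact ⟨x, Set.mem_biUnion hu hx⟩
    · rintro T ⟨t, ht, htT⟩ hT
      obtain ⟨u, hu, htu⟩ := Set.mem_iUnion₂.1 ht
      have hfib : ∀ u ∈ f w, (φ u ∩ T).Nonempty → φ u ⊆ T := fun u hu hne =>
        (hconn u (h4 w hu)).2 T hne fun x hx hxT y hy hxy =>
          hT x (Set.mem_biUnion hu hx) hxT y (Set.mem_biUnion hu hy) hxy
      have hall := (h1 w).2 {u | φ u ⊆ T} ⟨u, hu, hfib u hu ⟨t, htu, htT⟩⟩ (by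
        intro u hu huT v hv huv
        obtain ⟨u', hu', v', hv', huv'⟩ := hadj u (h4 w hu) v (h4 w hv) huv
        exact hfib v hv ⟨v', hv', hT u' (Set.mem_biUnion hu hu') (huT hu') v'
          (Set.mem_biUnion hv hv') huv'⟩)
      intro x hx
      obtain ⟨v, hv, hxv⟩ := Set.mem_iUnion₂.1 hx
      exact hall hv hxv
  · intro w w' hne
    rw [Set.disjoint_left]
    intro x hx hx'
    obtain ⟨u, hu, hxu⟩ := Set.mem_iUnion₂.1 hx
    obtain ⟨v, hv, hxv⟩ := Set.mem_iUnion₂.1 hx'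
    have huv : u ≠ v := by
      rintro rfl
      exact Set.disjoint_left.1 (h2 w w' hne) hu hv
    exact Set.disjoint_left.1 (hdisj u (h4 w hu) v (h4 w' hv) huv) hxu hxv
  · intro w w' hww
    obtain ⟨u, hu, v, hv, huv⟩ := h3 w w' hww
    obtain ⟨u', hu', v', hv', huv'⟩ := hadj u (h4 w hu) v (h4 w' hv) huv
    exact ⟨u', Set.mem_biUnion hu hu', v', Set.mem_biUnion hv hv', huv'⟩
  · intro w x hx
    obtain ⟨u, hu, hxu⟩ := Set.mem_iUnion₂.1 hx
    exact hsub u (h4 w hu) hxu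

theorem NonplanarOn.contract {V V' : Type} {H : SimpleGraph V}
    {H' : SimpleGraph V'} {X : Set V} {Y : Set V'} (h : NonplanarOn H X) (φ : V → Set V')
    (hconn : ∀ u ∈ X, ConnectedIn H' (φ u))
    (hdisj : ∀ u ∈ X, ∀ v ∈ X, u ≠ v → Disjoint (φ u) (φ v))
    (hadj : ∀ u ∈ X, ∀ v ∈ X, H.Adj u v → ∃ u' ∈ φ u, ∃ v' ∈ φ v, H'.Adj u' v')
    (hsub : ∀ u ∈ X, φ u ⊆ Y) : NonplanarOn H' Y :=
  h.imp (fun h => h.contract φ hconn hdisj hadj hsub)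
    (fun h => h.contract φ hconn hdisj hadj hsub)

theorem NonplanarOn.map {V V' : Type} {H : SimpleGraph V}
    {H' : SimpleGraph V'} {X : Set V} {Y : Set V'} (h : NonplanarOn H X) (φ : V → V')
    (hinj : Set.InjOn φ X)
    (hadj : ∀ u ∈ X, ∀ v ∈ X, H.Adj u v → H'.Adj (φ u) (φ v))
    (hsub : ∀ u ∈ X, φ u ∈ Y) : NonplanarOn H' Y := by
  refine h.contract (fun u => {φ u}) (fun u _ => ConnectedIn.singleton _ _) ?_ ?_ ?_
  · intro u hu v hv huv
    rw [Set.disjoint_singleton]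
    exact fun h => huv (hinj hu hv h)
  · intro u hu v hv huv
    exact ⟨_, rfl, _, rfl, hadj u hu v hv huv⟩
  · rintro u hu _ rfl
    exact hsub u hu

theorem NonplanarOn.mono {V : Type} {H H' : SimpleGraph V} {X Y : Set V}
    (h : NonplanarOn H X) (hadj : ∀ u ∈ X, ∀ v ∈ X, H.Adj u v → H'.Adj u v) (hsub : X ⊆ Y) :
    NonplanarOn H' Y :=
  h.map id (Set.injOn_id _) hadj hsub

theorem NonplanarOn.mono_set {V : Type} {H : SimpleGraph V} {X Y : Set V}
    (h : NonplanarOn H X) (hsub : X ⊆ Y) : NonplanarOn H Y :=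
  h.mono (fun _ _ _ _ h => h) hsub

theorem hasModelIn_self {W : Type} (Q : SimpleGraph W) : HasModelIn Q Q Set.univ :=
  ⟨fun w => {w}, fun _ => ConnectedIn.singleton _ _,
    fun _ _ h => Set.disjoint_singleton.2 h,
    fun w w' h => ⟨w, rfl, w', rfl, h⟩, fun _ => Set.subset_univ _⟩

theorem NonplanarOn.of_isSubdivision {V W : Type} {G : SimpleGraph V} {H : SimpleGraph W}
    (h : IsSubdivision G H) : NonplanarOn G Set.univ → NonplanarOn H Set.univ := by
  induction h with
  | of_iso e =>
    exact fun hG => hG.map e e.injective.injOn (fun u _ v _ huv => e.map_adj_iff.2 huv)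
      (fun _ _ => Set.mem_univ _)
  | @step _ _ _ H u v H' _ _ e ih =>
    intro hG
    have hsub : NonplanarOn (subdivideEdge H u v) Set.univ := by
      refine (ih hG).contract (fun x => {y | y = some x ∨ (x = u ∧ y = none)}) ?_ ?_ ?_
        (fun _ _ => Set.subset_univ _)
      · intro x _
        refine ⟨⟨some x, Or.inl rfl⟩, ?_⟩
        rintro T ⟨t, ht, htT⟩ hT y hy
        have hadj : (subdivideEdge H u v).Adj none (some u) := by
          simp [subdivideEdge]
        rcases ht with rfl | ⟨rfl, rfl⟩ <;> rcases hy with rfl | ⟨h1, rfl⟩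
        · exact htT
        · exact hT _ (Or.inl rfl) htT _ (Or.inr ⟨h1, rfl⟩) (h1 ▸ hadj.symm)
        · exact hT _ (Or.inr ⟨rfl, rfl⟩) htT _ (Or.inl rfl) hadj
        · exact htT
      · intro x _ y _ hxy
        rw [Set.disjoint_left]
        rintro z (rfl | ⟨rfl, rfl⟩) (h | ⟨h, h'⟩)
        · exact hxy (Option.some.inj h)
        · cases h'
        · cases h
        · exact hxy h.symm
      · intro x _ y _ hxy
        by_cases hs : s(x, y) = s(u, v)
        · rcases Sym2.eq_iff.1 hs with ⟨rfl, rfl⟩ | ⟨rfl, rfl⟩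
          · exact ⟨none, Or.inr ⟨rfl, rfl⟩, some y, Or.inl rfl, by simp [subdivideEdge]⟩
          · exact ⟨some x, Or.inl rfl, none, Or.inr ⟨rfl, rfl⟩, by simp [subdivideEdge]⟩
        · refine ⟨some x, Or.inl rfl, some y, Or.inl rfl, ?_⟩
          rw [subdivideEdge, SimpleGraph.fromRel_adj]
          exact ⟨fun h => hxy.ne (Option.some.inj h), Or.inl (Or.inl ⟨x, y, rfl, rfl, hxy, hs⟩)⟩
    exact hsub.map e e.injective.injOn (fun u _ v _ huv => e.map_adj_iff.2 huv)
      (fun _ _ => Set.mem_univ _)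

theorem IsKuratowski.nonplanarOn {V : Type} {G : SimpleGraph V} {H : G.Subgraph}
    (h : IsKuratowski H) : NonplanarOn H.spanningCoe H.verts := by
  have hn : NonplanarOn H.coe Set.univ := by
    rcases h with h | h
    · exact NonplanarOn.of_isSubdivision h (Or.inl (hasModelIn_self _))
    · exact NonplanarOn.of_isSubdivision h (Or.inr (hasModelIn_self _))
  exact hn.map Subtype.val Subtype.val_injective.injOn (fun u _ v _ huv => huv)
    (fun u _ => u.2)

theorem isPlanar_comap_iff {V W : Type} (H : SimpleGraph V) (φ : W → V)
    (hφ : Function.Injective φ) :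
    IsPlanar (H.comap φ) ↔ ¬ NonplanarOn H (Set.range φ) := by
  rw [isPlanar_iff, not_iff_not]
  constructor
  · exact fun h => h.map φ hφ.injOn (fun _ _ _ _ h => h) (fun u _ => ⟨u, rfl⟩)
  · intro h
    have hex : ∀ x ∈ Set.range φ, ∃ w, φ w = x := fun x hx => hx
    rcases isEmpty_or_nonempty W with hW | hW
    · obtain ⟨f, h1, -, -, h4⟩ | ⟨f, h1, -, -, h4⟩ := h <;>
      · obtain ⟨x, hx⟩ := (h1 0).1
        obtain ⟨w, -⟩ := h4 0 hx
        exact hW.elim w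
    · refine h.map (Function.invFun φ) ?_ ?_ (fun _ _ => Set.mem_univ _)
      · rintro _ ⟨u, rfl⟩ _ ⟨v, rfl⟩ huv
        simpa [Function.leftInverse_invFun hφ _] using congrArg φ huv
      · rintro _ ⟨u, rfl⟩ _ ⟨v, rfl⟩ huv
        simpa [Function.leftInverse_invFun hφ _] using huv

theorem NonplanarOn.not_subset_triple {V : Type} {H : SimpleGraph V} {X : Set V}
    (h : NonplanarOn H X) (p q r : V) : ¬ X ⊆ {p, q, r} := by
  classical
  intro hX
  have aux : ∀ (n : ℕ) (Q : SimpleGraph (Fin n)), HasModelIn Q H X → n ≤ 3 := by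
    rintro n Q ⟨f, h1, h2, -, h4⟩
    choose g hg using fun w => (h1 w).1
    have hinj : Function.Injective g := by
      intro w w' hww
      by_contra hne
      exact Set.disjoint_left.1 (h2 w w' hne) (hg w) (hww ▸ hg w')
    calc n = (Finset.univ.image g).card := by
            rw [Finset.card_image_of_injective _ hinj, Finset.card_univ, Fintype.card_fin]
      _ ≤ ({p, q, r} : Finset V).card := Finset.card_le_card (by
            intro x hx
            obtain ⟨w, -, rfl⟩ := Finset.mem_image.1 hx
            simpa using hX (h4 w (hg w)))
      _ ≤ 3 := Finset.card_le_three
  rcases h with h | h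
  · exact absurd (aux _ _ h) (by decide)
  · exact absurd (aux _ _ h) (by decide)

theorem K5_three_connected : ∀ (p q : Option (Fin 5)) (w w' : Fin 5),
    some w ≠ p → some w ≠ q → some w' ≠ p → some w' ≠ q →
    w = w' ∨ K5.Adj w w' ∨
      ∃ x, some x ≠ p ∧ some x ≠ q ∧ K5.Adj w x ∧ K5.Adj x w' := by
  intro p q w w' _ _ _ _
  by_cases h : w = w'
  · exact Or.inl h
  · exact Or.inr (Or.inl h)

theorem K33_adj_iff (i j : Fin 6) : K33.Adj i j ↔ ¬ (i.val < 3 ↔ j.val < 3) := by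
  rw [K33, SimpleGraph.fromRel_adj]
  constructor
  · omega
  · intro h
    refine ⟨?_, by omega⟩
    rintro rfl
    exact h Iff.rfl

theorem K33_three_connected (p q : Option (Fin 6)) (w w' : Fin 6)
    (_ : some w ≠ p) (_ : some w ≠ q) (_ : some w' ≠ p) (_ : some w' ≠ q) :
    w = w' ∨ K33.Adj w w' ∨
      ∃ x, some x ≠ p ∧ some x ≠ q ∧ K33.Adj w x ∧ K33.Adj x w' := by
  have low : ∀ p q : Option (Fin 6), ∃ x : Fin 6, x.val < 3 ∧ some x ≠ p ∧ some x ≠ q := by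
    decide
  have high : ∀ p q : Option (Fin 6), ∃ x : Fin 6, ¬ x.val < 3 ∧ some x ≠ p ∧ some x ≠ q := by
    decide
  simp only [K33_adj_iff]
  by_cases hw : w.val < 3 <;> by_cases hw' : w'.val < 3
  · obtain ⟨x, hx, hp, hq⟩ := high p q
    exact Or.inr (Or.inr ⟨x, hp, hq, by tauto, by tauto⟩)
  · exact Or.inr (Or.inl (by tauto))
  · exact Or.inr (Or.inl (by tauto))
  · obtain ⟨x, hx, hp, hq⟩ := low p q
    exact Or.inr (Or.inr ⟨x, hp, hq, by tauto, by tauto⟩)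

/-- Keep the side `K` of a separation with cut `{p, q}` in a minor model. -/
theorem model_restrict {W V : Type} {Q : SimpleGraph W} {H : SimpleGraph V} {X K : Set V}
    {p q : V} (hp : p ∉ K) (hq : q ∉ K)
    (hK : ∀ u ∈ X, ∀ v ∈ X, u ∈ K → H.Adj u v → v ∈ K ∨ v = p ∨ v = q)
    {f : W → Set V} (h1 : ∀ w, ConnectedIn H (f w))
    (h2 : ∀ w w', w ≠ w' → Disjoint (f w) (f w'))
    (h3 : ∀ w w', Q.Adj w w' → ∃ u ∈ f w, ∃ v ∈ f w', H.Adj u v)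
    (h4 : ∀ w, f w ⊆ X)
    (hside : ∀ w, p ∉ f w → q ∉ f w → f w ⊆ K) :
    HasModelIn Q (H ⊔ SimpleGraph.edge p q) (X ∩ {v | v ∈ K ∨ v = p ∨ v = q}) := by
  refine ⟨fun w => f w ∩ {v | v ∈ K ∨ v = p ∨ v = q}, ?_, ?_, ?_, ?_⟩
  · intro w
    constructor
    · by_cases hpw : p ∈ f w
      · exact ⟨p, hpw, Or.inr (Or.inl rfl)⟩
      by_cases hqw : q ∈ f w
      · exact ⟨q, hqw, Or.inr (Or.inr rfl)⟩
      obtain ⟨x, hx⟩ := (h1 w).1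
      exact ⟨x, hx, Or.inl (hside w hpw hqw hx)⟩
    · rintro T ⟨t, ⟨htw, htK⟩, htT⟩ hT
      have hpq : p ∈ f w → q ∈ f w → (p ∈ T ↔ q ∈ T) := by
        intro hpw hqw
        by_cases hne : p = q
        · rw [hne]
        have hadj : (H ⊔ SimpleGraph.edge p q).Adj p q := by
          simp [SimpleGraph.edge_adj, hne]
        exact ⟨fun h => hT p ⟨hpw, Or.inr (Or.inl rfl)⟩ h q ⟨hqw, Or.inr (Or.inr rfl)⟩ hadj,
          fun h => hT q ⟨hqw, Or.inr (Or.inr rfl)⟩ h p ⟨hpw, Or.inr (Or.inl rfl)⟩ hadj.symm⟩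
      have key := (h1 w).2 {v | ((v ∈ K ∨ v = p ∨ v = q) ∧ v ∈ T) ∨
          (¬ (v ∈ K ∨ v = p ∨ v = q) ∧ ((p ∈ f w ∧ p ∈ T) ∨ (q ∈ f w ∧ q ∈ T)))}
        ⟨t, htw, Or.inl ⟨htK, htT⟩⟩ (by
          intro u hu hu' v hv huv
          by_cases hvK : v ∈ K ∨ v = p ∨ v = q
          · refine Or.inl ⟨hvK, ?_⟩
            rcases hu' with ⟨huK, huT⟩ | ⟨huK, hpT⟩
            · exact hT u ⟨hu, huK⟩ huT v ⟨hv, hvK⟩ (Or.inl huv)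
            · rcases hvK with hvK | rfl | rfl
              · exact absurd (hK v (h4 w hv) u (h4 w hu) hvK huv.symm) huK
              · rcases hpT with h | h
                · exact h.2
                · exact (hpq hv h.1).2 h.2
              · rcases hpT with h | h
                · exact (hpq h.1 hv).1 h.2
                · exact h.2
          · refine Or.inr ⟨hvK, ?_⟩
            rcases hu' with ⟨huK | rfl | rfl, huT⟩ | ⟨huK, hpT⟩
            · exact absurd (hK u (h4 w hu) v (h4 w hv) huK huv) hvK
            · exact Or.inl ⟨hu, huT⟩
            · exact Or.inr ⟨hu, huT⟩
            · exact hpT)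
      rintro v ⟨hv, hvK⟩
      rcases key hv with h | h
      · exact h.2
      · exact absurd hvK h.1
  · intro w w' hne
    exact (h2 w w' hne).mono Set.inter_subset_left Set.inter_subset_left
  · intro w w' hww
    obtain ⟨u, hu, v, hv, huv⟩ := h3 w w' hww
    have hdis := h2 w w' hww.ne
    by_cases hK' : (u ∈ K ∨ u = p ∨ u = q) ∧ (v ∈ K ∨ v = p ∨ v = q)
    · exact ⟨u, ⟨hu, hK'.1⟩, v, ⟨hv, hK'.2⟩, Or.inl huv⟩
    have hu' : u ∉ K := fun h =>
      hK' ⟨Or.inl h, hK u (h4 w hu) v (h4 w' hv) h huv⟩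
    have hv' : v ∉ K := fun h =>
      hK' ⟨hK v (h4 w' hv) u (h4 w hu) h huv.symm, Or.inl h⟩
    have hw : p ∈ f w ∨ q ∈ f w := by
      by_contra! hc
      exact hu' (hside w hc.1 hc.2 hu)
    have hw' : p ∈ f w' ∨ q ∈ f w' := by
      by_contra! hc
      exact hv' (hside w' hc.1 hc.2 hv)
    have hadj : ∀ x ∈ f w, ∀ y ∈ f w', s(x, y) = s(p, q) →
        (H ⊔ SimpleGraph.edge p q).Adj x y := by
      intro x hx y hy hxy
      have hne : x ≠ y := by
        rintro rfl
        exact Set.disjoint_left.1 hdis hx hy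
      refine Or.inr ?_
      rw [SimpleGraph.edge_adj]
      rcases Sym2.eq_iff.1 hxy with ⟨rfl, rfl⟩ | ⟨rfl, rfl⟩
      · exact ⟨Or.inl ⟨rfl, rfl⟩, hne⟩
      · exact ⟨Or.inr ⟨rfl, rfl⟩, hne⟩
    rcases hw with hw | hw <;> rcases hw' with hw' | hw'
    · exact absurd hw' (Set.disjoint_left.1 hdis hw)
    · exact ⟨p, ⟨hw, Or.inr (Or.inl rfl)⟩, q, ⟨hw', Or.inr (Or.inr rfl)⟩, hadj p hw q hw' rfl⟩
    · exact ⟨q, ⟨hw, Or.inr (Or.inr rfl)⟩, p, ⟨hw', Or.inr (Or.inl rfl)⟩,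
        hadj q hw p hw' Sym2.eq_swap⟩
    · exact absurd hw' (Set.disjoint_left.1 hdis hw)
  · intro w
    exact Set.inter_subset_inter_left _ (h4 w)

theorem HasModelIn.separation {W V : Type} {Q : SimpleGraph W}
    (hQ : ∀ (p q : Option W) (w w' : W),
      some w ≠ p → some w ≠ q → some w' ≠ p → some w' ≠ q →
      w = w' ∨ Q.Adj w w' ∨ ∃ x, some x ≠ p ∧ some x ≠ q ∧ Q.Adj w x ∧ Q.Adj x w')
    {H : SimpleGraph V} {X : Set V} (h : HasModelIn Q H X) (A : Set V) {p q : V}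
    (hp : p ∉ A) (hq : q ∉ A)
    (hA : ∀ u ∈ X, ∀ v ∈ X, u ∈ A → H.Adj u v → v ∈ A ∨ v = p ∨ v = q) :
    HasModelIn Q (H ⊔ SimpleGraph.edge p q) (X ∩ {v | v ∈ A ∨ v = p ∨ v = q}) ∨
      HasModelIn Q (H ⊔ SimpleGraph.edge p q) (X \ A) := by
  obtain ⟨f, h1, h2, h3, h4⟩ := h
  by_cases hall : ∀ w, p ∉ f w → q ∉ f w → f w ⊆ A
  · exact Or.inl (model_restrict hp hq hA h1 h2 h3 h4 hall)
  right
  push Not at hall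
  obtain ⟨w₀, hp₀, hq₀, hw₀⟩ := hall
  have mark : ∀ r : V, ∃ o : Option W, ∀ w, r ∈ f w ↔ some w = o := by
    intro r
    by_cases hr : ∃ w, r ∈ f w
    · obtain ⟨w, hw⟩ := hr
      refine ⟨some w, fun w' => ⟨fun hw' => ?_, ?_⟩⟩
      · by_contra hne
        exact Set.disjoint_left.1 (h2 w' w fun h => hne (congrArg some h)) hw' hw
      · intro h
        rwa [Option.some.inj h]
    · exact ⟨none, fun w => ⟨fun hw => absurd ⟨w, hw⟩ hr, fun h => by cases h⟩⟩
  obtain ⟨op, hop⟩ := mark p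
  obtain ⟨oq, hoq⟩ := mark q
  have hinA : ∀ w, p ∉ f w → q ∉ f w → (f w ∩ A).Nonempty → f w ⊆ A := by
    intro w hpw hqw hne
    refine (h1 w).2 A hne fun u hu huA v hv huv => ?_
    rcases hA u (h4 w hu) v (h4 w hv) huA huv with h | rfl | rfl
    · exact h
    · exact absurd hv hpw
    · exact absurd hv hqw
  have hstep : ∀ w w', Q.Adj w w' → p ∉ f w → q ∉ f w → p ∉ f w' → q ∉ f w' →
      f w ⊆ A → f w' ⊆ A := by
    intro w w' hww hpw hqw hpw' hqw' hw
    obtain ⟨u, hu, v, hv, huv⟩ := h3 w w' hww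
    refine hinA w' hpw' hqw' ⟨v, hv, ?_⟩
    rcases hA u (h4 w hu) v (h4 w' hv) (hw hu) huv with h | rfl | rfl
    · exact h
    · exact absurd hv hpw'
    · exact absurd hv hqw'
  have hout : ∀ w, p ∉ f w → q ∉ f w → ¬ f w ⊆ A := by
    intro w hpw hqw hw
    apply hw₀
    rcases hQ op oq w w₀ (mt (hop w).2 hpw) (mt (hoq w).2 hqw) (mt (hop w₀).2 hp₀)
      (mt (hoq w₀).2 hq₀) with rfl | hadj | ⟨x, hxp, hxq, hwx, hxw⟩
    · exact hw
    · exact hstep w w₀ hadj hpw hqw hp₀ hq₀ hw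
    · have hpx := mt (hop x).1 hxp
      have hqx := mt (hoq x).1 hxq
      exact hstep x w₀ hxw hpx hqx hp₀ hq₀ (hstep w x hwx hpw hqw hpx hqx hw)
  obtain ⟨g, g1, g2, g3, g4⟩ := model_restrict (K := {v | v ∉ A ∧ v ≠ p ∧ v ≠ q}) (p := p) (q := q)
    (by simp) (by simp)
    (by
      rintro u hu v hv ⟨huA, hup, huq⟩ huv
      by_cases hvA : v ∈ A
      · rcases hA v hv u hu hvA huv.symm with h | h | h
        · exact absurd h huA
        · exact absurd h hup
        · exact absurd h huq
      · by_cases hvp : v = p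
        · exact Or.inr (Or.inl hvp)
        by_cases hvq : v = q
        · exact Or.inr (Or.inr hvq)
        exact Or.inl ⟨hvA, hvp, hvq⟩)
    h1 h2 h3 h4 (by
      intro w hpw hqw x hx
      refine ⟨fun hxA => hout w hpw hqw (hinA w hpw hqw ⟨x, hx, hxA⟩), ?_, ?_⟩
      · rintro rfl
        exact hpw hx
      · rintro rfl
        exact hqw hx)
  refine ⟨g, g1, g2, g3, fun w => (g4 w).trans ?_⟩
  rintro x ⟨hx, ⟨hxA, -⟩ | rfl | rfl⟩
  · exact ⟨hx, hxA⟩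
  · exact ⟨hx, hp⟩
  · exact ⟨hx, hq⟩

theorem NonplanarOn.separation {V : Type} {H : SimpleGraph V} {X : Set V}
    (h : NonplanarOn H X) (A : Set V) {p q : V} (hp : p ∉ A) (hq : q ∉ A)
    (hA : ∀ u ∈ X, ∀ v ∈ X, u ∈ A → H.Adj u v → v ∈ A ∨ v = p ∨ v = q) :
    NonplanarOn (H ⊔ SimpleGraph.edge p q) (X ∩ {v | v ∈ A ∨ v = p ∨ v = q}) ∨
      NonplanarOn (H ⊔ SimpleGraph.edge p q) (X \ A) := by
  rcases h with h | h
  · exact (h.separation K5_three_connected A hp hq hA).imp Or.inl Or.inl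
  · exact (h.separation K33_three_connected A hp hq hA).imp Or.inr Or.inr

theorem NonplanarOn.separation_one {V : Type} {H : SimpleGraph V} {X : Set V}
    (h : NonplanarOn H X) (A : Set V) {p : V} (hp : p ∉ A)
    (hA : ∀ u ∈ X, ∀ v ∈ X, u ∈ A → H.Adj u v → v ∈ A ∨ v = p) :
    NonplanarOn H (X ∩ {v | v ∈ A ∨ v = p}) ∨ NonplanarOn H (X \ A) := by
  simpa [SimpleGraph.edge_self_eq_bot] using
    h.separation A hp hp (fun u hu v hv huA huv => (hA u hu v hv huA huv).imp id Or.inl)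

/-- A virtual edge `pq` may be realised by a connected set outside of `X`. -/
theorem NonplanarOn.of_virtual_edge {V : Type} {H H' : SimpleGraph V} {X Y Z : Set V} {p q : V}
    (h : NonplanarOn (H ⊔ SimpleGraph.edge p q) X)
    (hH : ∀ u ∈ X, ∀ v ∈ X, H.Adj u v → H'.Adj u v)
    (hZ : ConnectedIn H' Z) (hpZ : p ∈ Z) (hZX : ∀ v ∈ Z, v ∈ X → v = p)
    (hZq : ∃ z ∈ Z, H'.Adj z q) (hXY : X ⊆ Y) (hZY : Z ⊆ Y) : NonplanarOn H' Y := by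
  classical
  have hmem : ∀ u, u ∈ (if u = p then Z else {u}) := by
    intro u
    split_ifs with h
    · exact h ▸ hpZ
    · rfl
  refine h.contract (fun u => if u = p then Z else {u}) ?_ ?_ ?_ ?_
  · intro u _
    split_ifs
    · exact hZ
    · exact ConnectedIn.singleton _ _
  · intro u hu v hv huv
    split_ifs with h1 h2 h2
    · exact absurd (h1.trans h2.symm) huv
    · exact Set.disjoint_singleton_right.2 fun h => h2 (hZX v h hv)
    · exact Set.disjoint_singleton_left.2 fun h => h1 (hZX u h hu)
    · exact Set.disjoint_singleton.2 huv
  · intro u hu v hv huv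
    rcases huv with huv | huv
    · exact ⟨u, hmem u, v, hmem v, hH u hu v hv huv⟩
    · rw [SimpleGraph.edge_adj] at huv
      obtain ⟨z, hz, hzq⟩ := hZq
      obtain ⟨⟨rfl, rfl⟩ | ⟨rfl, rfl⟩, hne⟩ := huv
      · exact ⟨z, by simpa using hz, v, hmem v, hzq⟩
      · exact ⟨u, hmem u, z, by simpa using hz, hzq.symm⟩
  · intro u hu
    split_ifs
    · exact hZY
    · exact Set.singleton_subset_iff.2 (hXY hu)

/-- Inside `U`, either `p` and `q` are joined by a connected set or they are separated by a
set closed under adjacency. -/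
theorem exists_connectedIn_or_closed {V : Type} (H : SimpleGraph V) {U : Set V} {p q : V}
    (hpq : p ≠ q) (hpU : p ∈ U) :
    (∃ Z ⊆ U, ConnectedIn H Z ∧ p ∈ Z ∧ q ∉ Z ∧ ∃ z ∈ Z, H.Adj z q) ∨
      ∃ X ⊆ U, p ∈ X ∧ q ∉ X ∧ ∀ u ∈ X, ∀ v ∈ U, H.Adj u v → v ∈ X := by
  let R : V → V → Prop := fun u v => H.Adj u v ∧ v ∈ U ∧ v ≠ q
  let Z : Set V := {v | Relation.ReflTransGen R p v}
  have hZ : ∀ v ∈ Z, v ∈ U ∧ v ≠ q := by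
    intro v hv
    rcases Relation.ReflTransGen.cases_tail hv with rfl | ⟨w, -, hw⟩
    · exact ⟨hpU, hpq⟩
    · exact hw.2
  have hp : p ∈ Z := Relation.ReflTransGen.refl
  have hcl : ∀ u ∈ Z, ∀ v ∈ U, v ≠ q → H.Adj u v → v ∈ Z :=
    fun u hu v hv hvq huv => Relation.ReflTransGen.tail hu ⟨huv, hv, hvq⟩
  by_cases hq : ∃ z ∈ Z, H.Adj z q
  · refine Or.inl ⟨Z, fun v hv => (hZ v hv).1, ⟨⟨p, hp⟩, ?_⟩, hp, fun h => (hZ q h).2 rfl, hq⟩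
    rintro T ⟨t, ht, htT⟩ hT
    have hback : ∀ v, Relation.ReflTransGen R p v → v ∈ T → p ∈ T := by
      intro v hv
      induction hv with
      | refl => exact id
      | @tail x y hx hxy ih =>
        exact fun hy => ih (hT y (Relation.ReflTransGen.tail hx hxy) hy x hx hxy.1.symm)
    have hpT := hback t ht htT
    intro v hv
    induction hv with
    | refl => exact hpT
    | @tail x y hx hxy ih => exact hT x hx ih y (Relation.ReflTransGen.tail hx hxy) hxy.1
  · refine Or.inr ⟨Z, fun v hv => (hZ v hv).1, hp, fun h => (hZ q h).2 rfl, ?_⟩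
    intro u hu v hv huv
    refine hcl u hu v hv ?_ huv
    rintro rfl
    exact hq ⟨u, hu, huv⟩

theorem IsApex.exists_of_comap {V W : Type} {H : SimpleGraph V} [Nonempty V] {φ : W → V}
    (hφ : Function.Injective φ) (h : IsApex (H.comap φ)) :
    ∃ z, ¬ NonplanarOn H (Set.range φ \ {z}) := by
  rcases h with h | ⟨w, h⟩
  · rw [isPlanar_comap_iff H φ hφ] at h
    obtain ⟨z⟩ := ‹Nonempty V›
    exact ⟨z, fun hn => h (hn.mono_set Set.sdiff_subset)⟩
  · refine ⟨φ w, fun hn => (isPlanar_comap_iff H (fun u : {u : W | u ≠ w} => φ u)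
      (hφ.comp Subtype.val_injective)).1 h (hn.mono_set ?_)⟩
    rintro _ ⟨⟨u, rfl⟩, hu⟩
    exact ⟨⟨u, fun h => hu (congrArg φ h)⟩, rfl⟩

theorem nonplanarOn_of_not_isApex {V : Type} {G : SimpleGraph V} (h : ¬ IsApex G) (z : V) :
    NonplanarOn G {z}ᶜ := by
  by_contra hn
  refine h (Or.inr ⟨z, ?_⟩)
  refine (isPlanar_comap_iff G (Subtype.val : {u : V | u ≠ z} → V) Subtype.val_injective).2 ?_
  exact fun h => hn (h.mono_set (by rintro _ ⟨u, rfl⟩; exact u.2))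

theorem IsApexObstruction.exists_of_lt {V : Type} [Finite V] [Nonempty V] {G H : SimpleGraph V}
    (hG : IsApexObstruction G) (hlt : H < G) : ∃ z, ¬ NonplanarOn H {z}ᶜ := by
  have hminor : H.IsMinorOf G :=
    ⟨fun w => {w}, fun w => (connectedIn_iff G _).1 (ConnectedIn.singleton _ _),
      fun w w' h => Set.disjoint_singleton.2 h,
      fun w w' h => ⟨w, rfl, w', rfl, hlt.le h⟩⟩
  have hiso : IsEmpty (H ≃g G) := by
    refine ⟨fun e => hlt.ne ?_⟩
    have hcard : Nat.card H.edgeSet = Nat.card G.edgeSet := Nat.card_congr e.mapEdgeSet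
    have hsub : H.edgeSet ⊆ G.edgeSet := SimpleGraph.edgeSet_mono hlt.le
    exact SimpleGraph.edgeSet_injective
      (Set.eq_of_subset_of_ncard_le hsub (by
        rw [← Nat.card_coe_set_eq, ← Nat.card_coe_set_eq, hcard]) (Set.toFinite _))
  obtain ⟨z, hz⟩ := IsApex.exists_of_comap (H := H) (φ := id) Function.injective_id
    (hG.2 V H hminor hiso)
  exact ⟨z, fun h => hz (h.mono_set fun v hv => ⟨⟨v, rfl⟩, hv⟩)⟩

/-- Minimality applied to the contraction of a connected set `T` to its vertex `x`. -/
theorem IsApexObstruction.exists_of_contract {V : Type} [Finite V] {G : SimpleGraph V}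
    (hG : IsApexObstruction G) (H : SimpleGraph V) {T : Set V} {x y : V}
    (hT : ConnectedIn G T) (hx : x ∈ T) (hy : y ∈ T) (hxy : y ≠ x)
    (hadj : ∀ u v, (u ∈ T → u = x) → (v ∈ T → v = x) → H.Adj u v →
      G.Adj u v ∨ (u = x ∧ ∃ t ∈ T, G.Adj t v) ∨ (v = x ∧ ∃ t ∈ T, G.Adj u t)) :
    ∃ z, ¬ NonplanarOn H ({v | v ∈ T → v = x} \ {z}) := by
  classical
  have : Nonempty V := ⟨x⟩
  let S : Set V := {v | v ∈ T → v = x}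
  have hmem : ∀ u, u ∈ (if u = x then T else {u}) := by
    intro u
    split_ifs with h
    · exact h ▸ hx
    · rfl
  have hminor : (H.comap (Subtype.val : S → V)).IsMinorOf G := by
    rw [← hasModelIn_univ_iff]
    refine (hasModelIn_self _).contract (fun u : S => if (u : V) = x then T else {(u : V)})
      ?_ ?_ ?_ (fun _ _ => Set.subset_univ _)
    · intro u _
      split_ifs
      · exact hT
      · exact ConnectedIn.singleton _ _
    · intro u _ v _ huv
      have huv' : (u : V) ≠ v := fun h => huv (Subtype.ext h)
      split_ifs with h1 h2 h2
      · exact absurd (h1.trans h2.symm) huv'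
      · exact Set.disjoint_singleton_right.2 fun h => h2 (v.2 h)
      · exact Set.disjoint_singleton_left.2 fun h => h1 (u.2 h)
      · exact Set.disjoint_singleton.2 huv'
    · intro u _ v _ huv
      rcases hadj u v u.2 v.2 huv with h | ⟨hu, t, ht, h⟩ | ⟨hv, t, ht, h⟩
      · exact ⟨u, hmem u, v, hmem v, h⟩
      · exact ⟨t, by simpa [hu] using ht, v, hmem v, h⟩
      · exact ⟨u, hmem u, t, by simpa [hv] using ht, h⟩
  have hiso : IsEmpty (H.comap (Subtype.val : S → V) ≃g G) := by
    refine ⟨fun e => ?_⟩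
    have hcard : Nat.card S = Nat.card V := Nat.card_congr e.toEquiv
    have hlt : S.ncard < (Set.univ : Set V).ncard :=
      Set.ncard_lt_ncard ⟨Set.subset_univ _, fun h => hxy (h (Set.mem_univ y) hy)⟩
        (Set.toFinite _)
    rw [Set.ncard_univ, ← Nat.card_coe_set_eq, hcard] at hlt
    exact lt_irrefl _ hlt
  obtain ⟨z, hz⟩ := IsApex.exists_of_comap Subtype.val_injective (hG.2 S _ hminor hiso)
  exact ⟨z, fun h => hz (h.mono_set (Set.sdiff_subset_sdiff_left (by simp [S])))⟩

/-- Facts about the unique 2-cut `{a, b}` and its light side `L`, symmetric in `a` and `b`. -/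
structure LightSide {V : Type} (G : SimpleGraph V) (a b : V) (L : Set V) : Prop where
  obs : IsApexObstruction G
  ne : a ≠ b
  cut : ∀ (Q : Set V) (p q r : V), Q.Nonempty → p ∉ Q → q ∉ Q → r ∉ Q → p ≠ q → r ≠ p → r ≠ q →
    (∀ u ∈ Q, ∀ v, G.Adj u v → v ∈ Q ∨ v = p ∨ v = q) → ({p, q} : Set V) = {a, b}
  left_notMem : a ∉ L
  right_notMem : b ∉ L
  closed : ∀ u ∈ L, ∀ v, G.Adj u v → v ∈ L ∨ v = a ∨ v = b
  planar_compl : ¬ NonplanarOn G {v | v ≠ a ∧ v ≠ b}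
  planar_left : ¬ NonplanarOn G {v | v ∈ L ∨ v = a}
  planar_right : ¬ NonplanarOn G {v | v ∈ L ∨ v = b}
  nonplanar_left : NonplanarOn G {v | v ∉ L ∧ v ≠ a}
  nonplanar_right : NonplanarOn G {v | v ∉ L ∧ v ≠ b}
  nonplanar_virtual : NonplanarOn (G ⊔ SimpleGraph.edge a b) {v | v ∈ L ∨ v = a ∨ v = b}

namespace LightSide

variable {V : Type} {G : SimpleGraph V} {a b : V} {L : Set V}

theorem symm (D : LightSide G a b L) : LightSide G b a L where
  obs := D.obs
  ne := D.ne.symm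
  cut Q p q r h1 h2 h3 h4 h5 h6 h7 h8 :=
    (D.cut Q p q r h1 h2 h3 h4 h5 h6 h7 h8).trans (Set.pair_comm a b)
  left_notMem := D.right_notMem
  right_notMem := D.left_notMem
  closed u hu v h := (D.closed u hu v h).imp id Or.symm
  planar_compl h := D.planar_compl (h.mono_set fun _ hv => hv.symm)
  planar_left := D.planar_right
  planar_right := D.planar_left
  nonplanar_left := D.nonplanar_right
  nonplanar_right := D.nonplanar_left
  nonplanar_virtual := by
    rw [SimpleGraph.edge_comm]
    exact D.nonplanar_virtual.mono_set fun _ hv => hv.imp id Or.symm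

/-- Apart from `{a, b}` there is no 2-cut. -/
theorem no_other_cut (D : LightSide G a b L) {Q : Set V} {p q r : V} (hQ : Q.Nonempty)
    (hp : p ∉ Q) (hq : q ∉ Q) (hr : r ∉ Q) (hpa : p ≠ a) (hpb : p ≠ b) (hpq : p ≠ q)
    (hrp : r ≠ p) (hrq : r ≠ q)
    (hcl : ∀ u ∈ Q, ∀ v, G.Adj u v → v ∈ Q ∨ v = p ∨ v = q) : False := by
  have h : p ∈ ({a, b} : Set V) := by
    rw [← D.cut Q p q r hQ hp hq hr hpq hrp hrq hcl]
    exact Or.inl rfl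
  rcases h with h | h
  · exact hpa h
  · exact hpb h

/-- No vertex outside `L ∪ {a, b}` separates `a` from `b` in `G - L`, even if `ab` is deleted. -/
theorem not_closed (D : LightSide G a b L) {z : V} (hza : z ≠ a) (hzb : z ≠ b)
    {X : Set V} (hX : ∀ v ∈ X, v ∉ L ∧ v ≠ z) (ha : a ∈ X) (hb : b ∉ X)
    (hcl : ∀ u ∈ X, ∀ v, v ∉ L → v ≠ z → G.Adj u v → v ∈ X ∨ (u = a ∧ v = b)) : False := by
  by_cases h1 : ∃ x ∈ X, x ≠ a
  · refine D.no_other_cut (Q := X \ {a}) (p := z) (q := a) (r := b) ?_ ?_ ?_ ?_ hza hzb hza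
      hzb.symm D.ne.symm ?_
    · obtain ⟨x, hx, hxa⟩ := h1
      exact ⟨x, hx, hxa⟩
    · exact fun h => (hX z h.1).2 rfl
    · exact fun h => h.2 rfl
    · exact fun h => hb h.1
    · rintro u ⟨hu, hua⟩ v huv
      by_cases hvz : v = z
      · exact Or.inr (Or.inl hvz)
      by_cases hva : v = a
      · exact Or.inr (Or.inr hva)
      have hvL : v ∉ L := by
        intro hv
        rcases D.closed v hv u huv.symm with h | h | h
        · exact (hX u hu).1 h
        · exact hua h
        · exact hb (h ▸ hu)
      rcases hcl u hu v hvL hvz huv with h | h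
      · exact Or.inl ⟨h, hva⟩
      · exact absurd h.1 hua
  by_cases h2 : ∃ y, y ∉ X ∧ y ∉ L ∧ y ≠ z ∧ y ≠ b
  · refine D.no_other_cut (Q := {y | y ∉ X ∧ y ∉ L ∧ y ≠ z ∧ y ≠ b}) (p := z) (q := b) (r := a)
      h2 ?_ ?_ ?_ hza hzb hzb hza.symm D.ne ?_
    · exact fun h => h.2.2.1 rfl
    · exact fun h => h.2.2.2 rfl
    · exact fun h => h.1 ha
    · rintro u ⟨huX, huL, huz, hub⟩ v huv
      by_cases hvz : v = z
      · exact Or.inr (Or.inl hvz)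
      by_cases hvb : v = b
      · exact Or.inr (Or.inr hvb)
      refine Or.inl ⟨?_, ?_, hvz, hvb⟩
      · intro hv
        rcases hcl v hv u huL huz huv.symm with h | h
        · exact huX h
        · exact hub h.2
      · intro hv
        rcases D.closed v hv u huv.symm with h | h | h
        · exact huL h
        · exact huX (h ▸ ha)
        · exact hub h
  · refine D.nonplanar_left.not_subset_triple z b b ?_
    rintro v ⟨hvL, hva⟩
    by_cases hvz : v = z
    · exact Or.inl hvz
    by_cases hvb : v = b
    · exact Or.inr (Or.inl hvb)
    exact absurd ⟨v, fun hv => h1 ⟨v, hv, hva⟩, hvL, hvz, hvb⟩ h2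

/-- A subgraph that is nonplanar off `b` is already nonplanar off `L ∪ {b}`. -/
theorem nonplanarOn_of_compl (D : LightSide G a b L) {H : SimpleGraph V} (hH : H ≤ G)
    (h : NonplanarOn H {b}ᶜ) : NonplanarOn H {v | v ∉ L ∧ v ≠ b} := by
  rcases h.separation_one L D.left_notMem (by
    intro u _ v hv hu huv
    rcases D.closed u hu v (hH huv) with h | h | h
    · exact Or.inl h
    · exact Or.inr h
    · exact absurd h hv) with h | h
  · exact absurd (h.mono (fun u _ v _ huv => hH huv) fun v hv => hv.2) D.planar_left
  · exact h.mono_set fun v hv => ⟨hv.2, hv.1⟩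

theorem nonplanarOn_half (D : LightSide G a b L) {z : V}
    {X Y : Set V} (hcov : ∀ v, v ∉ L → v = z ∨ v ∈ X ∨ v ∈ Y)
    (hzX : z ∉ X) (ha : a ∈ X) {H : SimpleGraph V} (hH : H ≤ G)
    (hcross : ∀ u ∈ X, ∀ v ∈ Y, ¬ H.Adj u v) (hN : NonplanarOn H {v | v ∉ L ∧ v ≠ b}) :
    NonplanarOn H {v | v ∈ X ∨ v = z} := by
  rcases hN.separation_one X hzX (by
    intro u _ v hv hu huv
    rcases hcov v hv.1 with h | h | h
    · exact Or.inr h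
    · exact Or.inl h
    · exact absurd huv (hcross u hu v h)) with h | h
  · exact h.mono_set fun v hv => hv.2
  · refine absurd (h.mono (fun u _ v _ huv => hH huv) ?_) D.planar_compl
    rintro v ⟨hv, hvX⟩
    refine ⟨?_, hv.2⟩
    rintro rfl
    exact hvX ha

theorem exists_cross_edge (D : LightSide G a b L) {z : V} (hza : z ≠ a) (hzb : z ≠ b)
    {X Y : Set V} (hcov : ∀ v, v ∉ L → v = z ∨ v ∈ X ∨ v ∈ Y)
    (hX : ∀ v ∈ X, v ∉ L ∧ v ≠ z ∧ v ∉ Y) (hb : b ∈ Y)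
    (hN : NonplanarOn G {v | v ∈ X ∨ v = z}) :
    ∃ u ∈ X, ∃ v ∈ Y, u ≠ a ∧ G.Adj u v := by
  by_contra! hno
  have hbX : b ∉ X := fun h => (hX b h).2.2 hb
  refine D.no_other_cut (Q := X \ {a}) (p := z) (q := a) (r := b) ?_ ?_ ?_ ?_ hza hzb hza
    hzb.symm D.ne.symm ?_
  · by_contra hne
    refine hN.not_subset_triple z a a ?_
    rintro v (hv | rfl)
    · by_contra hva
      exact hne ⟨v, hv, fun h => hva (Or.inr (Or.inl h))⟩
    · exact Or.inl rfl
  · exact fun h => (hX z h.1).2.1 rfl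
  · exact fun h => h.2 rfl
  · exact fun h => hbX h.1
  · rintro u ⟨hu, hua⟩ v huv
    by_cases hva : v = a
    · exact Or.inr (Or.inr hva)
    have hvL : v ∉ L := by
      intro hv
      rcases D.closed v hv u huv.symm with h | h | h
      · exact (hX u hu).1 h
      · exact hua h
      · exact hbX (h ▸ hu)
    rcases hcov v hvL with h | h | h
    · exact Or.inr (Or.inl h)
    · exact Or.inl ⟨h, hva⟩
    · exact absurd huv (hno u hu v h hua)

theorem not_closed_half (D : LightSide G a b L) {z : V} (hzb : z ≠ b)
    {X Y : Set V} (hcov : ∀ v, v ∉ L → v = z ∨ v ∈ X ∨ v ∈ Y)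
    (hX : ∀ v ∈ X, v ∉ L ∧ v ≠ z ∧ v ∉ Y) (hb : b ∈ Y)
    (hN : NonplanarOn G {v | v ∈ X ∨ v = z}) {x y : V} (hx : x ∈ X) (hxa : x ≠ a) (hy : y ∈ Y)
    (hcross : ∀ u ∈ X, ∀ v ∈ Y, G.Adj u v → s(u, v) = s(x, y))
    {Q : Set V} (hQX : ∀ v ∈ Q, v ∈ X ∧ v ≠ x) (ha : a ∈ Q)
    (hcl : ∀ u ∈ Q, ∀ v, v ∈ X ∨ v = z → v ≠ x → G.Adj u v → v ∈ Q) : False := by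
  have hbX : b ∉ X := fun h => (hX b h).2.2 hb
  have hxQ : x ∉ Q := fun h => (hQX x h).2 rfl
  rcases hN.separation_one Q hxQ (by
    intro u _ v hv hu huv
    by_cases hvx : v = x
    · exact Or.inr hvx
    · exact Or.inl (hcl u hu v hv hvx huv)) with h | h
  · refine D.no_other_cut (Q := Q \ {a}) (p := x) (q := a) (r := b) ?_ ?_ ?_ ?_ hxa ?_ hxa
      ?_ D.ne.symm ?_
    · by_contra hne
      refine h.not_subset_triple x a a ?_
      rintro v ⟨-, hv | rfl⟩
      · by_contra hva
        exact hne ⟨v, hv, fun h => hva (Or.inr (Or.inl h))⟩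
      · exact Or.inl rfl
    · exact fun h => hxQ h.1
    · exact fun h => h.2 rfl
    · exact fun h => hbX (hQX b h.1).1
    · rintro rfl
      exact hbX hx
    · rintro rfl
      exact hbX hx
    · rintro u ⟨hu, hua⟩ v huv
      have huX := (hQX u hu).1
      by_cases hva : v = a
      · exact Or.inr (Or.inr hva)
      by_cases hvx : v = x
      · exact Or.inr (Or.inl hvx)
      have hvL : v ∉ L := by
        intro hv
        rcases D.closed v hv u huv.symm with h | h | h
        · exact (hX u huX).1 h
        · exact hua h
        · exact hbX (h ▸ huX)
      have hvXz : v ∈ X ∨ v = z := by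
        rcases hcov v hvL with h | h | h
        · exact Or.inr h
        · exact Or.inl h
        · rcases Sym2.eq_iff.1 (hcross u huX v h huv) with ⟨h1, -⟩ | ⟨h1, -⟩
          · exact absurd h1 (hQX u hu).2
          · exact absurd (h1 ▸ hy) (hX u huX).2.2
      exact Or.inl ⟨hcl u hu v hvXz hvx huv, hva⟩
  · refine absurd (h.mono_set ?_) D.planar_compl
    rintro v ⟨hv, hvQ⟩
    constructor
    · rintro rfl
      exact hvQ ha
    · rintro rfl
      rcases hv with hv | hv
      · exact hbX hv
      · exact hzb hv.symm

/-- An edge outside `G[L ∪ {a, b}]` cannot be avoided by obstructions to planarity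
of `G - a` and of `G - b`. -/
theorem false_of_avoided_edge [Finite V] (D : LightSide G a b L) {e₁ e₂ : V}
    (hadj : G.Adj e₁ e₂) (h1 : e₁ ∉ L) (h1a : e₁ ≠ a) (h1b : e₁ ≠ b)
    (hA : NonplanarOn (G.deleteEdges {s(e₁, e₂)}) {a}ᶜ)
    (hB : NonplanarOn (G.deleteEdges {s(e₁, e₂)}) {b}ᶜ) : False := by
  classical
  have : Nonempty V := ⟨a⟩
  set G' := G.deleteEdges {s(e₁, e₂)} with hG'
  have hle : G' ≤ G := SimpleGraph.deleteEdges_le _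
  have hG'adj : ∀ u v, G.Adj u v → s(u, v) ≠ s(e₁, e₂) → G'.Adj u v := by
    intro u v huv hne
    rw [hG', SimpleGraph.deleteEdges_adj]
    exact ⟨huv, hne⟩
  have hlt : G' < G := by
    refine lt_of_le_of_ne hle fun h => ?_
    have : G'.Adj e₁ e₂ := h ▸ hadj
    rw [hG', SimpleGraph.deleteEdges_adj] at this
    exact this.2 rfl
  obtain ⟨z, hz⟩ := D.obs.exists_of_lt hlt
  have hA' := D.symm.nonplanarOn_of_compl hle hA
  have hB' := D.nonplanarOn_of_compl hle hB
  have hza : z ≠ a := by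
    rintro rfl
    exact hz hA
  have hzb : z ≠ b := by
    rintro rfl
    exact hz hB
  have hzL : z ∉ L := fun h => hz (hA'.mono_set fun v hv hvz => hv.1 (by
    rw [Set.mem_singleton_iff.1 hvz]
    exact h))
  rcases exists_connectedIn_or_closed G' (U := {v | v ∉ L ∧ v ≠ z}) D.ne
    ⟨D.left_notMem, hza.symm⟩ with ⟨Z, hZU, hZ, haZ, hbZ, hZb⟩ | ⟨X, hXU, ha, hb, hcl⟩
  · refine hz (D.nonplanar_virtual.of_virtual_edge ?_ hZ haZ ?_ hZb ?_ ?_)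
    · intro u hu v hv huv
      refine hG'adj u v huv fun h => ?_
      have he : e₁ ∈ L ∨ e₁ = a ∨ e₁ = b := by
        rcases Sym2.eq_iff.1 h with ⟨rfl, -⟩ | ⟨-, rfl⟩
        · exact hu
        · exact hv
      tauto
    · rintro v hv (h | h | h)
      · exact absurd h (hZU hv).1
      · exact h
      · exact absurd (h ▸ hv) hbZ
    · rintro v (h | rfl | rfl)
      · rintro rfl
        exact hzL h
      · exact hza.symm
      · exact hzb.symm
    · exact fun v hv => (hZU hv).2
  obtain ⟨Y, hY⟩ : ∃ Y : Set V, ∀ v, v ∈ Y ↔ v ∉ L ∧ v ≠ z ∧ v ∉ X := ⟨{v | _}, fun v => Iff.rfl⟩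
  have hXp : ∀ v ∈ X, v ∉ L ∧ v ≠ z ∧ v ∉ Y := fun v hv =>
    ⟨(hXU hv).1, (hXU hv).2, fun h => ((hY v).1 h).2.2 hv⟩
  have hYp : ∀ v ∈ Y, v ∉ L ∧ v ≠ z ∧ v ∉ X := fun v hv => (hY v).1 hv
  have hbY : b ∈ Y := (hY b).2 ⟨D.right_notMem, hzb.symm, hb⟩
  have hcov : ∀ v, v ∉ L → v = z ∨ v ∈ X ∨ v ∈ Y := by
    intro v hv
    by_cases h1 : v = z
    · exact Or.inl h1
    by_cases h2 : v ∈ X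
    · exact Or.inr (Or.inl h2)
    · exact Or.inr (Or.inr ((hY v).2 ⟨hv, h1, h2⟩))
  have hcov' : ∀ v, v ∉ L → v = z ∨ v ∈ Y ∨ v ∈ X := fun v hv => (hcov v hv).imp id Or.symm
  have hcross : ∀ u ∈ X, ∀ v ∈ Y, ¬ G'.Adj u v := fun u hu v hv huv =>
    (hYp v hv).2.2 (hcl u hu v ⟨(hYp v hv).1, (hYp v hv).2.1⟩ huv)
  have hNX : NonplanarOn G {v | v ∈ X ∨ v = z} :=
    (D.nonplanarOn_half hcov (fun h => (hXp z h).2.1 rfl) ha hle hcross hB').mono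
      (fun _ _ _ _ h => hle h) subset_rfl
  have hNY : NonplanarOn G {v | v ∈ Y ∨ v = z} :=
    (D.symm.nonplanarOn_half hcov' (fun h => (hYp z h).2.1 rfl) hbY hle
      (fun u hu v hv huv => hcross v hv u hu huv.symm) hA').mono
      (fun _ _ _ _ h => hle h) subset_rfl
  have hE : ∀ u ∈ X, ∀ v ∈ Y, G.Adj u v → s(u, v) = s(e₁, e₂) := by
    intro u hu v hv huv
    by_contra hne
    exact hcross u hu v hv (hG'adj u v huv hne)
  obtain ⟨x, hx, y, hy, hxa, hxy⟩ := D.exists_cross_edge hza hzb hcov hXp hbY hNX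
  have hyb : y ≠ b := by
    obtain ⟨y', hy', x', hx', hyb, hyx⟩ :=
      D.symm.exists_cross_edge hzb hza hcov' hYp ha hNY
    have h := (hE x hx y hy hxy).trans (hE x' hx' y' hy' hyx.symm).symm
    rcases Sym2.eq_iff.1 h with ⟨-, rfl⟩ | ⟨rfl, -⟩
    · exact hyb
    · exact absurd hx (hYp _ hy').2.2
  have hE' : ∀ u ∈ X, ∀ v ∈ Y, G.Adj u v → s(u, v) = s(x, y) := fun u hu v hv huv =>
    (hE u hu v hv huv).trans (hE x hx y hy hxy).symm
  have hya : y ≠ a := by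
    rintro rfl
    exact (hYp _ hy).2.2 ha
  have hxb : x ≠ b := by
    rintro rfl
    exact hb hx
  have hyX : ∀ v ∈ X, v ≠ y := by
    rintro v hv rfl
    exact (hYp _ hy).2.2 hv
  have hxY : ∀ v ∈ Y, v ≠ x := by
    rintro v hv rfl
    exact (hYp _ hv).2.2 hx
  have hzx : z ≠ x := (hXp x hx).2.1.symm
  have hzy : z ≠ y := (hYp y hy).2.1.symm
  set H := contractEdge G x y with hH
  have hHadj : ∀ u v, u ≠ y → v ≠ y → G.Adj u v → H.Adj u v := by
    intro u v hu hv huv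
    rw [hH, contractEdge, SimpleGraph.fromRel_adj]
    exact ⟨huv.ne, Or.inl ⟨hu, hv, Or.inl huv⟩⟩
  have hHx : ∀ v, v ≠ x → v ≠ y → G.Adj y v → H.Adj x v := by
    intro v hvx hvy hyv
    rw [hH, contractEdge, SimpleGraph.fromRel_adj]
    exact ⟨hvx.symm, Or.inl ⟨hxy.ne, hvy, Or.inr (Or.inl ⟨rfl, hyv⟩)⟩⟩
  have hHvirt : ∀ u ∈ {v | v ∈ L ∨ v = a ∨ v = b}, ∀ v ∈ {v | v ∈ L ∨ v = a ∨ v = b},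
      G.Adj u v → H.Adj u v := by
    have hne : ∀ u ∈ {v | v ∈ L ∨ v = a ∨ v = b}, u ≠ y := by
      rintro u (h | rfl | rfl) rfl
      · exact (hYp _ hy).1 h
      · exact hya rfl
      · exact hyb rfl
    exact fun u hu v hv huv => hHadj u v (hne u hu) (hne v hv) huv
  obtain ⟨z', hz'⟩ := D.obs.exists_of_contract H (T := {x, y}) (x := x) (y := y)
    (by
      refine ⟨⟨x, Or.inl rfl⟩, ?_⟩
      rintro T ⟨t, rfl | rfl, htT⟩ hT
      · rintro _ (rfl | rfl)
        · exact htT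
        · exact hT _ (Or.inl rfl) htT _ (Or.inr rfl) hxy
      · rintro _ (rfl | rfl)
        · exact hT _ (Or.inr rfl) htT _ (Or.inl rfl) hxy.symm
        · exact htT)
    (Or.inl rfl) (Or.inr rfl) hxy.ne' (by
      intro u v _ _ huv
      rw [hH, contractEdge, SimpleGraph.fromRel_adj] at huv
      obtain ⟨-, ⟨-, -, h | ⟨h, h'⟩ | ⟨h, h'⟩⟩ | ⟨-, -, h | ⟨h, h'⟩ | ⟨h, h'⟩⟩⟩ := huv
      · exact Or.inl h
      · exact Or.inr (Or.inl ⟨h, y, Or.inr rfl, h'⟩)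
      · exact Or.inr (Or.inr ⟨h, y, Or.inr rfl, h'⟩)
      · exact Or.inl h.symm
      · exact Or.inr (Or.inr ⟨h, y, Or.inr rfl, h'.symm⟩)
      · exact Or.inr (Or.inl ⟨h, y, Or.inr rfl, h'.symm⟩))
  have hS : ∀ v, v ≠ y → v ≠ z' → v ∈ {v | v ∈ ({x, y} : Set V) → v = x} \ {z'} := by
    refine fun v hv hvz => ⟨?_, hvz⟩
    rintro (h | h)
    · exact h
    · exact absurd h hv
  by_cases hz'z : z' = z
  · subst hz'z
    rcases exists_connectedIn_or_closed H (U := {v | v ∉ L ∧ v ≠ z' ∧ v ≠ y}) D.ne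
      ⟨D.left_notMem, hza.symm, hya.symm⟩ with
      ⟨Z, hZU, hZ, haZ, hbZ, hZb⟩ | ⟨X', hXU', ha', hb', hcl'⟩
    · refine hz' (D.nonplanar_virtual.of_virtual_edge hHvirt hZ haZ ?_ hZb ?_ ?_)
      · rintro v hv (h | h | h)
        · exact absurd h (hZU hv).1
        · exact h
        · exact absurd (h ▸ hv) hbZ
      · rintro v (h | rfl | rfl)
        · refine hS v ?_ ?_
          · rintro rfl
            exact (hYp _ hy).1 h
          · rintro rfl
            exact hzL h
        · exact hS _ hya.symm hza.symm
        · exact hS _ hyb.symm hzb.symm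
      · exact fun v hv => hS v (hZU hv).2.2 (hZU hv).2.1
    · refine D.not_closed (X := {v | v ∈ X' ∨ (v = y ∧ x ∈ X')}) hza hzb ?_ (Or.inl ha') ?_ ?_
      · rintro v (hv | ⟨rfl, -⟩)
        · exact ⟨(hXU' hv).1, (hXU' hv).2.1⟩
        · exact ⟨(hYp _ hy).1, (hYp _ hy).2.1⟩
      · rintro (h | ⟨h, -⟩)
        · exact hb' h
        · exact hyb h.symm
      · rintro u hu v hvL hvz huv
        left
        rcases hu with hu | ⟨rfl, hxX'⟩
        · have huy : u ≠ y := (hXU' hu).2.2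
          by_cases hvy : v = y
          · refine Or.inr ⟨hvy, ?_⟩
            by_cases hux : u = x
            · exact hux ▸ hu
            · exact hcl' u hu x ⟨(hXp x hx).1, hzx.symm, hxy.ne⟩
                (hHx u hux huy (hvy ▸ huv.symm)).symm
          · exact Or.inl (hcl' u hu v ⟨hvL, hvz, hvy⟩ (hHadj u v huy hvy huv))
        · left
          by_cases hvx : v = x
          · exact hvx ▸ hxX'
          · exact hcl' x hxX' v ⟨hvL, hvz, huv.ne'⟩ (hHx v hvx huv.ne' huv)
  by_cases hz'x : z' = x
  · subst hz'x
    rcases exists_connectedIn_or_closed H (U := {v | v ∉ L ∧ v ≠ z' ∧ v ≠ y}) D.ne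
      ⟨D.left_notMem, hxa.symm, hya.symm⟩ with
      ⟨Z, hZU, hZ, haZ, hbZ, hZb⟩ | ⟨X', hXU', ha', hb', hcl'⟩
    · refine hz' (D.nonplanar_virtual.of_virtual_edge hHvirt hZ haZ ?_ hZb ?_ ?_)
      · rintro v hv (h | h | h)
        · exact absurd h (hZU hv).1
        · exact h
        · exact absurd (h ▸ hv) hbZ
      · rintro v (h | rfl | rfl)
        · refine hS v ?_ ?_
          · rintro rfl
            exact (hYp _ hy).1 h
          · rintro rfl
            exact (hXp _ hx).1 h
        · exact hS _ hya.symm hxa.symm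
        · exact hS _ hyb.symm hxb.symm
      · exact fun v hv => hS v (hZU hv).2.2 (hZU hv).2.1
    by_cases hzX' : z ∈ X'
    · refine D.symm.not_closed_half hza hcov' hYp ha hNY hy hyb hx
        (fun u hu v hv huv => by
          rw [Sym2.eq_swap, hE' v hv u hu huv.symm, Sym2.eq_swap])
        (Q := {v | v ∈ Y ∧ v ∉ X' ∧ v ≠ y}) (fun v hv => ⟨hv.1, hv.2.2⟩)
        ⟨hbY, hb', hyb.symm⟩ ?_
      rintro u ⟨huY, huX', huy⟩ v hv hvy huv
      have hvX' : v ∉ X' := fun h => huX' (hcl' v h u ⟨(hYp u huY).1, hxY u huY, huy⟩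
        (hHadj v u hvy huy huv.symm))
      refine ⟨?_, hvX', hvy⟩
      rcases hv with hv | rfl
      · exact hv
      · exact absurd hzX' hvX'
    · refine D.not_closed_half hzb hcov hXp hbY hNX hx hxa hy hE'
        (Q := {v | v ∈ X' ∧ v ∈ X}) (fun v hv => ⟨hv.2, (hXU' hv.1).2.1⟩) ⟨ha', ha⟩ ?_
      rintro u ⟨huX', huX⟩ v hv hvx huv
      have hvLy : v ∉ L ∧ v ≠ y := by
        rcases hv with hv | rfl
        · exact ⟨(hXp v hv).1, hyX v hv⟩
        · exact ⟨hzL, hzy⟩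
      have hvX' : v ∈ X' := hcl' u huX' v ⟨hvLy.1, hvx, hvLy.2⟩
        (hHadj u v (hyX u huX) hvLy.2 huv)
      refine ⟨hvX', ?_⟩
      rcases hv with hv | rfl
      · exact hv
      · exact absurd hvX' hzX'
  by_cases hz'X : z' ∈ X
  · have hne : ∀ u ∈ {v | v ∈ Y ∨ v = z}, u ≠ x := by
      rintro u (hu | rfl)
      · exact hxY u hu
      · exact hzx
    refine hz' (hNY.map (fun v => if v = y then x else v) ?_ ?_ ?_)
    · intro u hu v hv huv
      dsimp only at huv
      split_ifs at huv with h1 h2 h2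
      · exact h1.trans h2.symm
      · exact absurd huv.symm (hne v hv)
      · exact absurd huv (hne u hu)
      · exact huv
    · intro u hu v hv huv
      split_ifs with h1 h2 h2
      · exact absurd (h1.trans h2.symm) huv.ne
      · exact hHx v (hne v hv) h2 (h1 ▸ huv)
      · exact (hHx u (hne u hu) h1 (h2 ▸ huv.symm)).symm
      · exact hHadj u v h1 h2 huv
    · intro u hu
      split_ifs with h
      · exact hS x hxy.ne (Ne.symm hz'x)
      · refine hS u h ?_
        rintro rfl
        rcases hu with hu | hu
        · exact (hYp _ hu).2.2 hz'X
        · exact hz'z hu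
  · have hne : ∀ u ∈ {v | v ∈ X ∨ v = z}, u ≠ y := by
      rintro u (hu | rfl)
      · exact hyX u hu
      · exact hzy
    refine hz' (hNX.mono (fun u hu v hv huv => hHadj u v (hne u hu) (hne v hv) huv) ?_)
    intro u hu
    refine hS u (hne u hu) ?_
    rintro rfl
    rcases hu with hu | hu
    · exact hz'X hu
    · exact hz'z hu

theorem not_adj [Finite V] (D : LightSide G a b L) : ¬ G.Adj a b := by
  intro hadj
  have : Nonempty V := ⟨a⟩
  set G' := G.deleteEdges {s(a, b)} with hG'
  have hG'adj : ∀ u v, G.Adj u v → s(u, v) ≠ s(a, b) → G'.Adj u v := by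
    intro u v huv hne
    rw [hG', SimpleGraph.deleteEdges_adj]
    exact ⟨huv, hne⟩
  have hlt : G' < G := by
    refine lt_of_le_of_ne (SimpleGraph.deleteEdges_le _) fun h => ?_
    have : G'.Adj a b := h ▸ hadj
    rw [hG', SimpleGraph.deleteEdges_adj] at this
    exact this.2 rfl
  obtain ⟨z, hz⟩ := D.obs.exists_of_lt hlt
  have hA : NonplanarOn G' {v | v ∉ L ∧ v ≠ a} := D.nonplanar_left.mono (by
    intro u hu v hv huv
    refine hG'adj u v huv fun h => ?_
    rcases Sym2.eq_iff.1 h with ⟨h, -⟩ | ⟨-, h⟩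
    · exact hu.2 h
    · exact hv.2 h) subset_rfl
  have hB : NonplanarOn G' {v | v ∉ L ∧ v ≠ b} := D.nonplanar_right.mono (by
    intro u hu v hv huv
    refine hG'adj u v huv fun h => ?_
    rcases Sym2.eq_iff.1 h with ⟨-, h⟩ | ⟨h, -⟩
    · exact hv.2 h
    · exact hu.2 h) subset_rfl
  have hza : z ≠ a := by
    rintro rfl
    exact hz (hA.mono_set fun v hv => hv.2)
  have hzb : z ≠ b := by
    rintro rfl
    exact hz (hB.mono_set fun v hv => hv.2)
  have hzL : z ∉ L := fun h => hz (hA.mono_set fun v hv hvz => hv.1 (by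
    rw [Set.mem_singleton_iff.1 hvz]
    exact h))
  rcases exists_connectedIn_or_closed G' (U := {v | v ∉ L ∧ v ≠ z}) D.ne
    ⟨D.left_notMem, hza.symm⟩ with ⟨Z, hZU, hZ, haZ, hbZ, hZb⟩ | ⟨X, hXU, ha, hb, hcl⟩
  · have hvirt : NonplanarOn (G' ⊔ SimpleGraph.edge a b) {v | v ∈ L ∨ v = a ∨ v = b} :=
      D.nonplanar_virtual.mono (by
        intro u _ v _ huv
        by_cases h : s(u, v) = s(a, b)
        · refine Or.inr ?_
          rw [SimpleGraph.edge_adj]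
          exact ⟨(Sym2.eq_iff.1 h).imp id id, huv.ne⟩
        · exact huv.imp (fun huv => hG'adj u v huv h) id) subset_rfl
    refine hz (hvirt.of_virtual_edge (fun _ _ _ _ h => h) hZ haZ ?_ hZb ?_ ?_)
    · rintro v hv (h | h | h)
      · exact absurd h (hZU hv).1
      · exact h
      · exact absurd (h ▸ hv) hbZ
    · rintro v (h | rfl | rfl)
      · rintro rfl
        exact hzL h
      · exact hza.symm
      · exact hzb.symm
    · exact fun v hv => (hZU hv).2
  · refine D.not_closed hza hzb (X := X) (fun v hv => hXU hv) ha hb ?_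
    intro u hu v hvL hvz huv
    by_cases h : s(u, v) = s(a, b)
    · rcases Sym2.eq_iff.1 h with h | h
      · exact Or.inr h
      · exact absurd (h.1 ▸ hu) hb
    · exact Or.inl (hcl u hu v ⟨hvL, hvz⟩ (hG'adj u v huv h))

theorem nonplanarOn_side (D : LightSide G a b L) {x y : V} (hadj : G.Adj x y)
    {A B : Set V} (hcov : ∀ v, v ∉ L → v = x ∨ v = y ∨ v ∈ A ∨ v ∈ B)
    (hA : ∀ v ∈ A, v ∉ L ∧ v ≠ x ∧ v ≠ y ∧ v ∉ B) (ha : a ∈ A)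
    (hcross : ∀ u ∈ A, ∀ v ∈ B, ¬ G.Adj u v) :
    NonplanarOn G {v | v ∈ A ∨ v = x ∨ v = y} := by
  have hedge : ∀ u v, (G ⊔ SimpleGraph.edge x y).Adj u v → G.Adj u v := by
    rintro u v (h | h)
    · exact h
    · rw [SimpleGraph.edge_adj] at h
      obtain ⟨⟨rfl, rfl⟩ | ⟨rfl, rfl⟩, -⟩ := h
      · exact hadj
      · exact hadj.symm
  rcases D.nonplanar_right.separation A (p := x) (q := y) (fun h => (hA x h).2.1 rfl)
    (fun h => (hA y h).2.2.1 rfl) (by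
      intro u _ v hv hu huv
      rcases hcov v hv.1 with h | h | h | h
      · exact Or.inr (Or.inl h)
      · exact Or.inr (Or.inr h)
      · exact Or.inl h
      · exact absurd huv (hcross u hu v h)) with h | h
  · exact h.mono (fun u _ v _ huv => hedge u v huv) fun v hv => hv.2
  · refine absurd (h.mono (fun u _ v _ huv => hedge u v huv) ?_) D.planar_compl
    rintro v ⟨hv, hvA⟩
    refine ⟨?_, hv.2⟩
    rintro rfl
    exact hvA ha

theorem nonplanarOn_delete_cut_edge (D : LightSide G a b L) {x y : V} (hadj : G.Adj x y)
    (hxa : x ≠ a) (hxb : x ≠ b) (hya : y ≠ a) (hyb : y ≠ b)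
    {A B : Set V} (hcov : ∀ v, v ∉ L → v = x ∨ v = y ∨ v ∈ A ∨ v ∈ B)
    (hA : ∀ v ∈ A, v ∉ L ∧ v ≠ x ∧ v ≠ y ∧ v ∉ B)
    (hB : ∀ v ∈ B, v ∉ L ∧ v ≠ x ∧ v ≠ y ∧ v ∉ A) (ha : a ∈ A) (hb : b ∈ B)
    (hcross : ∀ u ∈ A, ∀ v ∈ B, ¬ G.Adj u v) :
    NonplanarOn (G.deleteEdges {s(x, y)}) {b}ᶜ := by
  have hNA := D.nonplanarOn_side hadj hcov hA ha hcross
  have hNB := D.symm.nonplanarOn_side hadj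
    (fun v hv => (hcov v hv).imp id (Or.imp id Or.symm)) hB hb
    (fun u hu v hv huv => hcross v hv u hu huv.symm)
  set G' := G.deleteEdges {s(x, y)} with hG'
  have hG'adj : ∀ u v, G.Adj u v → s(u, v) ≠ s(x, y) → G'.Adj u v := by
    intro u v huv hne
    rw [hG', SimpleGraph.deleteEdges_adj]
    exact ⟨huv, hne⟩
  have hBadj : ∀ u ∈ B, ∀ v, G.Adj u v → G'.Adj u v := by
    intro u hu v huv
    refine hG'adj u v huv fun h => ?_
    rcases Sym2.eq_iff.1 h with ⟨h, -⟩ | ⟨h, -⟩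
    · exact (hB u hu).2.1 h
    · exact (hB u hu).2.2.1 h
  have hBnbr : ∀ u ∈ B, u ≠ b → ∀ v, G.Adj u v → v = x ∨ v = y ∨ v ∈ B := by
    intro u hu hub v huv
    have hvL : v ∉ L := by
      intro hv
      rcases D.closed v hv u huv.symm with h | h | h
      · exact (hB u hu).1 h
      · exact (hA a ha).2.2.2 (h ▸ hu)
      · exact hub h
    rcases hcov v hvL with h | h | h | h
    · exact Or.inl h
    · exact Or.inr (Or.inl h)
    · exact absurd huv.symm (hcross v h u hu)
    · exact Or.inr (Or.inr h)
  rcases exists_connectedIn_or_closed G' (U := {v | (v ∈ B ∨ v = x ∨ v = y) ∧ v ≠ b}) hadj.ne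
    ⟨Or.inr (Or.inl rfl), hxb⟩ with ⟨Z, hZU, hZ, hxZ, hyZ, hZy⟩ | ⟨Q, hQU, hxQ, hyQ, hcl⟩
  · have hvirt : NonplanarOn (G' ⊔ SimpleGraph.edge x y) {v | v ∈ A ∨ v = x ∨ v = y} :=
      hNA.mono (by
        intro u _ v _ huv
        by_cases h : s(u, v) = s(x, y)
        · refine Or.inr ?_
          rw [SimpleGraph.edge_adj]
          exact ⟨(Sym2.eq_iff.1 h).imp id id, huv.ne⟩
        · exact Or.inl (hG'adj u v huv h)) subset_rfl
    refine hvirt.of_virtual_edge (fun _ _ _ _ h => h) hZ hxZ ?_ hZy ?_ fun v hv => (hZU hv).2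
    · rintro v hv (h | h | h)
      · rcases (hZU hv).1 with h' | h' | h'
        · exact absurd h' (hA v h).2.2.2
        · exact h'
        · exact absurd (h' ▸ hv) hyZ
      · exact h
      · exact absurd (h ▸ hv) hyZ
    · rintro v (h | rfl | rfl)
      · rintro rfl
        exact (hA _ h).2.2.2 hb
      · exact hxb
      · exact hyb
  exfalso
  have haB : a ∉ B := (hA a ha).2.2.2
  have hQB : ∀ u ∈ Q, u ≠ x → u ∈ B ∧ u ≠ b := by
    intro u hu hux
    refine ⟨?_, (hQU hu).2⟩
    rcases (hQU hu).1 with h | h | h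
    · exact h
    · exact absurd h hux
    · exact absurd (h ▸ hu) hyQ
  by_cases h1 : ∃ v ∈ Q, v ≠ x
  · refine D.no_other_cut (Q := Q \ {x}) (p := x) (q := b) (r := a) ?_ ?_ ?_ ?_ hxa hxb hxb
      hxa.symm D.ne ?_
    · obtain ⟨v, hv, hvx⟩ := h1
      exact ⟨v, hv, hvx⟩
    · exact fun h => h.2 rfl
    · exact fun h => (hQU h.1).2 rfl
    · exact fun h => haB (hQB a h.1 hxa.symm).1
    · rintro u ⟨hu, hux⟩ v huv
      obtain ⟨huB, hub⟩ := hQB u hu hux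
      by_cases hvx : v = x
      · exact Or.inr (Or.inl hvx)
      by_cases hvb : v = b
      · exact Or.inr (Or.inr hvb)
      refine Or.inl ⟨hcl u hu v ⟨?_, hvb⟩ (hBadj u huB v huv), hvx⟩
      rcases hBnbr u huB hub v huv with h | h | h
      · exact Or.inr (Or.inl h)
      · exact Or.inr (Or.inr h)
      · exact Or.inl h
  by_cases h2 : ∃ v ∈ B, v ≠ b
  · refine D.no_other_cut (Q := B \ {b}) (p := y) (q := b) (r := a) ?_ ?_ ?_ ?_ hya hyb hyb
      hya.symm D.ne ?_
    · obtain ⟨v, hv, hvb⟩ := h2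
      exact ⟨v, hv, hvb⟩
    · exact fun h => (hB y h.1).2.2.1 rfl
    · exact fun h => h.2 rfl
    · exact fun h => haB h.1
    · rintro u ⟨hu, hub⟩ v huv
      by_cases hvb : v = b
      · exact Or.inr (Or.inr hvb)
      rcases hBnbr u hu hub v huv with h | h | h
      · refine absurd ⟨u, ?_, (hB u hu).2.1⟩ h1
        exact hcl x hxQ u ⟨Or.inl hu, hub⟩ (h ▸ (hBadj u hu v huv).symm)
      · exact Or.inr (Or.inl h)
      · exact Or.inl ⟨h, hvb⟩
  · refine hNB.not_subset_triple b x y ?_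
    rintro v (hv | hv)
    · by_contra hne
      exact h2 ⟨v, hv, fun h => hne (Or.inl h)⟩
    · exact Or.inr hv

end LightSide

theorem connectedIn_univ_of_vConn {V : Type} [Fintype V] {G : SimpleGraph V} (hk : vConn G = 2) :
    ConnectedIn G Set.univ := by
  have hne : {k : ℕ | ∀ s : Finset V, s.card < k →
      (G.induce ((↑s : Set V)ᶜ)).Connected}.Nonempty := by
    rw [Set.nonempty_iff_ne_empty]
    intro h
    rw [vConn, h] at hk
    simp at hk
  have hbdd : BddAbove {k : ℕ | ∀ s : Finset V, s.card < k →
      (G.induce ((↑s : Set V)ᶜ)).Connected} := by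
    by_contra h
    rw [vConn, Nat.sSup_of_not_bddAbove h] at hk
    simp at hk
  have hmem := Nat.sSup_mem hne hbdd
  have h := (connectedIn_iff G _).2 (hmem ∅ (by
    rw [Finset.card_empty]
    change 0 < vConn G
    omega))
  simpa using h

theorem IsApexObstruction.not_disjoint_nonplanarOn {V : Type} [Finite V] {G : SimpleGraph V}
    (hG : IsApexObstruction G) (hconn : ConnectedIn G Set.univ) {X Y : Set V}
    (hX : NonplanarOn G X) (hY : NonplanarOn G Y) (hd : ∀ v ∈ X, v ∉ Y) : False := by
  obtain ⟨p, -⟩ := hconn.1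
  have : Nonempty V := ⟨p⟩
  have hne : ∀ {Z : Set V}, NonplanarOn G Z → Z.Nonempty := by
    intro Z hZ
    by_contra h
    rw [Set.not_nonempty_iff_eq_empty] at h
    exact hZ.not_subset_triple p p p (h ▸ Set.empty_subset _)
  obtain ⟨u, hu, v, hv, huv⟩ : ∃ u ∈ X, ∃ v, v ∉ X ∧ G.Adj u v := by
    by_contra! hno
    obtain ⟨x, hx⟩ := hne hX
    obtain ⟨y, hy⟩ := hne hY
    refine hd y (hconn.2 X ⟨x, Set.mem_univ x, hx⟩ ?_ (Set.mem_univ y)) hy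
    intro u _ hu v _ huv
    by_contra hv
    exact hno u hu v hv huv
  have hlt : G.deleteEdges {s(u, v)} < G := by
    refine lt_of_le_of_ne (SimpleGraph.deleteEdges_le _) fun h => ?_
    have huv' := huv
    rw [← h, SimpleGraph.deleteEdges_adj] at huv'
    exact huv'.2 rfl
  obtain ⟨z, hz⟩ := hG.exists_of_lt hlt
  by_cases hzX : z ∈ X
  · refine hz (hY.mono ?_ ?_)
    · intro s hs t ht hst
      rw [SimpleGraph.deleteEdges_adj]
      refine ⟨hst, fun h => ?_⟩
      rcases Sym2.eq_iff.1 h with ⟨rfl, -⟩ | ⟨-, rfl⟩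
      · exact hd _ hu hs
      · exact hd _ hu ht
    · rintro w hw rfl
      exact hd _ hzX hw
  · refine hz (hX.mono ?_ ?_)
    · intro s hs t ht hst
      rw [SimpleGraph.deleteEdges_adj]
      refine ⟨hst, fun h => ?_⟩
      rcases Sym2.eq_iff.1 h with ⟨-, rfl⟩ | ⟨rfl, -⟩
      · exact hv ht
      · exact hv hs
    · rintro w hw rfl
      exact hzX hw

theorem IsKuratowskiWitness.nonplanarOn {V : Type} {G : SimpleGraph V} {v : V} {H : G.Subgraph}
    (h : IsKuratowskiWitness G v H) : NonplanarOn G H.verts :=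
  h.1.nonplanarOn.mono (fun _ _ _ _ h => H.adj_sub h) subset_rfl

theorem IsKuratowskiWitness.nonplanarOn_deleteEdges {V : Type} {G : SimpleGraph V} {v : V}
    {H : G.Subgraph} (h : IsKuratowskiWitness G v H) {x y : V} (hxy : ¬ H.Adj x y) :
    NonplanarOn (G.deleteEdges {s(x, y)}) {v}ᶜ := by
  refine h.1.nonplanarOn.mono ?_ ?_
  · intro s _ t _ hst
    rw [SimpleGraph.deleteEdges_adj]
    refine ⟨H.adj_sub hst, fun he => hxy ?_⟩
    rcases Sym2.eq_iff.1 he with ⟨rfl, rfl⟩ | ⟨rfl, rfl⟩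
    · exact hst
    · exact H.adj_symm hst
  · rintro w hw rfl
    exact h.2 hw

theorem IsCompOf.connectedIn {V : Type} {G : SimpleGraph V} {S C : Set V} (h : IsCompOf G S C) :
    ConnectedIn G C :=
  (connectedIn_iff G C).2 h.2.2.1

theorem IsCompOf.subset_of_mem {V : Type} {G : SimpleGraph V} {S C D : Set V}
    (hC : IsCompOf G S C) (hD : IsCompOf G S D) {v : V} (hvC : v ∈ C) (hvD : v ∈ D) : C ⊆ D :=
  hC.connectedIn.2 D ⟨v, hvC, hvD⟩ fun u _ huD w hw huw =>
    hD.2.2.2 u huD w (Set.disjoint_left.1 hC.2.1 hw) huw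

theorem IsTwoCut.of_closed {V : Type} {G : SimpleGraph V} {Q : Set V} {p q r : V}
    (hQ : Q.Nonempty) (hp : p ∉ Q) (hq : q ∉ Q) (hr : r ∉ Q) (hpq : p ≠ q) (hrp : r ≠ p)
    (hrq : r ≠ q) (hcl : ∀ u ∈ Q, ∀ v, G.Adj u v → v ∈ Q ∨ v = p ∨ v = q) :
    IsTwoCut G {p, q} := by
  refine ⟨Set.ncard_pair hpq, fun hpre => hr ?_⟩
  have hrS : r ∈ ({p, q} : Set V)ᶜ := by
    rintro (h | h)
    · exact hrp h
    · exact hrq h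
  have hconn : ConnectedIn G ({p, q} : Set V)ᶜ :=
    (connectedIn_iff G _).2 ((SimpleGraph.connected_iff _).2 ⟨hpre, ⟨⟨r, hrS⟩⟩⟩)
  refine hconn.2 Q ?_ ?_ hrS
  · obtain ⟨x, hx⟩ := hQ
    refine ⟨x, ?_, hx⟩
    rintro (rfl | rfl)
    · exact hp hx
    · exact hq hx
  · intro u _ hu v hv huv
    rcases hcl u hu v huv with h | h | h
    · exact h
    · exact absurd (Or.inl h) hv
    · exact absurd (Or.inr h) hv

/-- The light component of the unique 2-cut satisfies `LightSide`. -/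
theorem LightSide.of_isCompOf {V : Type} [Finite V] {G : SimpleGraph V} {a b : V} {C L : Set V}
    (hobs : IsApexObstruction G) (hconn : ConnectedIn G Set.univ)
    (huniq : ∀ T : Set V, IsTwoCut G T → T = ({a, b} : Set V))
    (hab : a ≠ b) (hC : IsCompOf G {a, b} C) (hL : IsCompOf G {a, b} L)
    (hCL : ∀ v ∈ C, v ∉ L) (hplanar : ¬ NonplanarOn G C)
    (hCa : NonplanarOn G {v | v ∈ C ∨ v = b}) (hCb : NonplanarOn G {v | v ∈ C ∨ v = a}) :
    LightSide G a b L := by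
  have haL : a ∉ L := fun h => Set.disjoint_left.1 hL.2.1 h (Or.inl rfl)
  have hbL : b ∉ L := fun h => Set.disjoint_left.1 hL.2.1 h (Or.inr rfl)
  have haC : a ∉ C := fun h => Set.disjoint_left.1 hC.2.1 h (Or.inl rfl)
  have hbC : b ∉ C := fun h => Set.disjoint_left.1 hC.2.1 h (Or.inr rfl)
  have hcut : ∀ (Q : Set V) (p q r : V), Q.Nonempty → p ∉ Q → q ∉ Q → r ∉ Q → p ≠ q → r ≠ p →
      r ≠ q → (∀ u ∈ Q, ∀ v, G.Adj u v → v ∈ Q ∨ v = p ∨ v = q) → ({p, q} : Set V) = {a, b} :=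
    fun Q p q r h1 h2 h3 h4 h5 h6 h7 h8 =>
      huniq _ (IsTwoCut.of_closed h1 h2 h3 h4 h5 h6 h7 h8)
  have hLcl : ∀ u ∈ L, ∀ v, G.Adj u v → v ∈ L ∨ v = a ∨ v = b := by
    intro u hu v huv
    by_cases hv : v ∈ ({a, b} : Set V)
    · exact Or.inr hv
    · exact Or.inl (hL.2.2.2 u hu v hv huv)
  obtain ⟨c, hc⟩ := hC.1
  have hca : c ≠ a := fun h => haC (h ▸ hc)
  have hcb : c ≠ b := fun h => hbC (h ▸ hc)
  have hcab : c ∉ ({a, b} : Set V) := by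
    rintro (h | h)
    · exact hca h
    · exact hcb h
  obtain ⟨l, hl, hla⟩ : ∃ l ∈ L, G.Adj l a := by
    by_contra! hno
    refine hcab (hcut L b c a hL.1 hbL (hCL c hc) haL hcb.symm hab hca.symm ?_ ▸ Or.inr rfl)
    intro u hu v huv
    rcases hLcl u hu v huv with h | rfl | h
    · exact Or.inl h
    · exact absurd huv (hno u hu)
    · exact Or.inr (Or.inl h)
  obtain ⟨m, hm, hmb⟩ : ∃ m ∈ L, G.Adj m b := by
    by_contra! hno
    refine hcab (hcut L a c b hL.1 haL (hCL c hc) hbL hca.symm hab.symm hcb.symm ?_ ▸ Or.inr rfl)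
    intro u hu v huv
    rcases hLcl u hu v huv with h | h | rfl
    · exact Or.inl h
    · exact Or.inr (Or.inl h)
    · exact absurd huv (hno u hu)
  refine ⟨hobs, hab, hcut, haL, hbL, hLcl, ?_, ?_, ?_, ?_, ?_, ?_⟩
  · intro h
    rcases h.separation_one C (p := a) haC (by
      intro u _ v hv hu huv
      refine Or.inl (hC.2.2.2 u hu v ?_ huv)
      rintro (h | h)
      · exact hv.1 h
      · exact hv.2 h) with h | h
    · refine hplanar (h.mono_set ?_)
      rintro v ⟨hv, hvC | hva⟩
      · exact hvC
      · exact absurd hva hv.1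
    · refine hobs.not_disjoint_nonplanarOn hconn hCa h ?_
      rintro v (hv | rfl) hv'
      · exact hv'.2 hv
      · exact hv'.1.2 rfl
  · intro h
    refine hobs.not_disjoint_nonplanarOn hconn hCa h ?_
    rintro v (hv | rfl) (hv' | rfl)
    · exact hCL v hv hv'
    · exact haC hv
    · exact hbL hv'
    · exact hab rfl
  · intro h
    refine hobs.not_disjoint_nonplanarOn hconn hCb h ?_
    rintro v (hv | rfl) (hv' | rfl)
    · exact hCL v hv hv'
    · exact hbC hv
    · exact haL hv'
    · exact hab rfl
  · refine hCa.mono_set ?_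
    rintro v (hv | rfl)
    · exact ⟨hCL v hv, fun h => haC (h ▸ hv)⟩
    · exact ⟨hbL, hab.symm⟩
  · refine hCb.mono_set ?_
    rintro v (hv | rfl)
    · exact ⟨hCL v hv, fun h => hbC (h ▸ hv)⟩
    · exact ⟨haL, hab⟩
  · have hT : ConnectedIn G {v | v ∈ L ∨ v = a} := by
      refine ⟨⟨a, Or.inr rfl⟩, ?_⟩
      rintro T ⟨t, ht, htT⟩ hT
      have hLT : (L ∩ T).Nonempty := by
        rcases ht with ht | rfl
        · exact ⟨t, ht, htT⟩
        · exact ⟨l, hl, hT _ (Or.inr rfl) htT l (Or.inl hl) hla.symm⟩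
      have hsub : L ⊆ T := hL.connectedIn.2 T hLT fun u hu huT v hv huv =>
        hT u (Or.inl hu) huT v (Or.inl hv) huv
      rintro v (hv | rfl)
      · exact hsub hv
      · exact hT l (Or.inl hl) (hsub hl) _ (Or.inr rfl) hla
    obtain ⟨z, hz⟩ := hobs.exists_of_contract (G ⊔ SimpleGraph.edge a b) hT (x := a) (y := l)
      (Or.inr rfl) (Or.inl hl) hla.ne (by
        rintro u v _ _ (huv | huv)
        · exact Or.inl huv
        · rw [SimpleGraph.edge_adj] at huv
          obtain ⟨⟨rfl, rfl⟩ | ⟨rfl, rfl⟩, -⟩ := huv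
          · exact Or.inr (Or.inl ⟨rfl, m, Or.inl hm, hmb⟩)
          · exact Or.inr (Or.inr ⟨rfl, m, Or.inl hm, hmb.symm⟩))
    have hS : ∀ v, v ∉ L → v ≠ z → v ∈ {v | v ∈ {v | v ∈ L ∨ v = a} → v = a} \ {z} := by
      refine fun v hv hvz => ⟨?_, hvz⟩
      rintro (h | h)
      · exact absurd h hv
      · exact h
    have hzC : z ∈ C := by
      by_contra hzC
      by_cases hzb : z = b
      · refine hz (hCb.mono (fun _ _ _ _ h => Or.inl h) ?_)
        rintro v (hv | rfl)
        · refine hS v (hCL v hv) ?_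
          rintro rfl
          exact hzC hv
        · exact hS _ haL (hzb ▸ hab)
      · refine hz (hCa.mono (fun _ _ _ _ h => Or.inl h) ?_)
        rintro v (hv | rfl)
        · refine hS v (hCL v hv) ?_
          rintro rfl
          exact hzC hv
        · exact hS _ hbL (Ne.symm hzb)
    rcases (nonplanarOn_of_not_isApex hobs.1 z).separation L haL hbL
      (fun u _ v _ hu huv => hLcl u hu v huv) with h | h
    · exact h.mono_set fun v hv => hv.2
    · exact absurd (h.mono_set fun v hv => hS v hv.2 hv.1) hz

/-- Basic structure under the standard assumptions (unique 2-cut, planar heavy side). -/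
theorem last_case_structure {V : Type} [Fintype V] (G : SimpleGraph V) (a b : V) (C L : Set V)
    (hobs : IsApexObstruction G)
    (hk : vConn G = 2)
    (hcut : IsTwoCut G {a, b})
    (huniq : ∀ T : Set V, IsTwoCut G T → T = ({a, b} : Set V))
    (hab : a ≠ b)
    (hheavy : IsHeavyComp G a b C)
    (hlight : IsCompOf G {a, b} L) (hLC : L ≠ C)
    (hplanarC : IsPlanar (G.induce C)) :
    (∀ Ha Hb : G.Subgraph, IsKuratowskiWitness G a Ha → IsKuratowskiWitness G b Hb →
      b ∈ Ha.verts ∧ a ∈ Hb.verts) ∧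
    (¬ G.Adj a b) ∧
    (∀ Ha Hb : G.Subgraph, IsKuratowskiWitness G a Ha → IsKuratowskiWitness G b Hb →
      ∀ u v : V, G.Adj u v →
        (u ∈ L ∪ {a, b} ∧ v ∈ L ∪ {a, b}) ∨ Ha.Adj u v ∨ Hb.Adj u v) ∧
    (∀ x y : V, x ∈ C → y ∈ C → x ≠ y →
      Separates (restrictTo G (C ∪ {a, b})) {x, y} a b → ¬ G.Adj x y) := by
  have hconn := connectedIn_univ_of_vConn hk
  obtain ⟨hC, ⟨Ha₀, hHa₀, hHa₀C⟩, ⟨Hb₀, hHb₀, hHb₀C⟩⟩ := hheavy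
  have hCL : ∀ v ∈ C, v ∉ L := fun v hvC hvL =>
    hLC ((hlight.subset_of_mem hC hvL hvC).antisymm (hC.subset_of_mem hlight hvC hvL))
  have hplanar : ¬ NonplanarOn G C := fun h =>
    (isPlanar_comap_iff G (Subtype.val : C → V) Subtype.val_injective).1 hplanarC
      (h.mono_set (by simp))
  have hCa : NonplanarOn G {v | v ∈ C ∨ v = b} := hHa₀.nonplanarOn.mono_set (by
    intro v hv
    rcases hHa₀C hv with h | rfl | h
    · exact Or.inl h
    · exact absurd hv hHa₀.2
    · exact Or.inr h)
  have hCb : NonplanarOn G {v | v ∈ C ∨ v = a} := hHb₀.nonplanarOn.mono_set (by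
    intro v hv
    rcases hHb₀C hv with h | h | rfl
    · exact Or.inl h
    · exact Or.inr h
    · exact absurd hv hHb₀.2)
  have D : LightSide G a b L :=
    LightSide.of_isCompOf hobs hconn huniq hab hC hlight hCL hplanar hCa hCb
  have haC : a ∉ C := fun h => Set.disjoint_left.1 hC.2.1 h (Or.inl rfl)
  have hbC : b ∉ C := fun h => Set.disjoint_left.1 hC.2.1 h (Or.inr rfl)
  refine ⟨?_, D.not_adj, ?_, ?_⟩
  · intro Ha Hb hHa hHb
    constructor
    · by_contra hb
      refine D.planar_compl (hHa.nonplanarOn.mono_set fun v hv => ⟨?_, ?_⟩)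
      · rintro rfl
        exact hHa.2 hv
      · rintro rfl
        exact hb hv
    · by_contra ha
      refine D.planar_compl (hHb.nonplanarOn.mono_set fun v hv => ⟨?_, ?_⟩)
      · rintro rfl
        exact ha hv
      · rintro rfl
        exact hHb.2 hv
  · intro Ha Hb hHa hHb
    have key : ∀ u v, G.Adj u v → u ∉ L ∪ {a, b} → ¬ Ha.Adj u v → ¬ Hb.Adj u v → False := by
      intro u v huv hu hua hub
      exact D.false_of_avoided_edge huv (fun h => hu (Or.inl h))
        (fun h => hu (Or.inr (Or.inl h))) (fun h => hu (Or.inr (Or.inr h)))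
        (hHa.nonplanarOn_deleteEdges hua) (hHb.nonplanarOn_deleteEdges hub)
    intro u v huv
    by_contra! hno
    by_cases hu : u ∈ L ∪ {a, b}
    · exact key v u huv.symm (hno.1 hu) (fun h => hno.2.1 h.symm) (fun h => hno.2.2 h.symm)
    · exact key u v huv hu hno.2.1 hno.2.2
  · intro x y hx hy hxy hsep hadj
    have hcover : ∀ v, v ∉ L → v ∈ C ∪ {a, b} := by
      intro v hvL
      by_contra hv
      have hva : v ≠ a := fun h => hv (Or.inr (Or.inl h))
      have hvb : v ≠ b := fun h => hv (Or.inr (Or.inr h))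
      have hvC : v ∉ C := fun h => hv (Or.inl h)
      obtain ⟨w, hw⟩ : ∃ w, G.Adj v w := by
        by_contra! hno
        refine hva (hconn.2 {v} ⟨v, Set.mem_univ v, rfl⟩ ?_ (Set.mem_univ a)).symm
        rintro u _ rfl w _ huw
        exact absurd huw (hno w)
      have hdel : ∀ X : Set V, v ∉ X → ∀ s ∈ X, ∀ t ∈ X, G.Adj s t →
          (G.deleteEdges {s(v, w)}).Adj s t := by
        intro X hvX s hs t ht hst
        rw [SimpleGraph.deleteEdges_adj]
        refine ⟨hst, fun h => hvX ?_⟩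
        rcases Sym2.eq_iff.1 h with ⟨rfl, -⟩ | ⟨-, rfl⟩
        · exact hs
        · exact ht
      refine D.false_of_avoided_edge hw hvL hva hvb
        (hCa.mono (hdel _ fun h => h.elim hvC hvb) ?_)
        (hCb.mono (hdel _ fun h => h.elim hvC hva) ?_)
      · rintro u (hu | rfl) rfl
        · exact haC hu
        · exact hab rfl
      · rintro u (hu | rfl) rfl
        · exact hbC hu
        · exact hab rfl
    obtain ⟨hasep, -, hwalk⟩ := hsep
    have hxa : x ≠ a := fun h => hasep (Or.inl h.symm)
    have hya : y ≠ a := fun h => hasep (Or.inr h.symm)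
    have hxb : x ≠ b := fun h => hbC (h ▸ hx)
    have hyb : y ≠ b := fun h => hbC (h ▸ hy)
    obtain ⟨A, hAdef⟩ : ∃ A : Set V, ∀ v, v ∈ A ↔ v ∈ C ∪ {a, b} ∧
        ∃ p : (restrictTo G (C ∪ {a, b})).Walk a v, x ∉ p.support ∧ y ∉ p.support :=
      ⟨{v | _}, fun v => Iff.rfl⟩
    obtain ⟨B, hBdef⟩ : ∃ B : Set V, ∀ v, v ∈ B ↔ v ∉ L ∧ v ≠ x ∧ v ≠ y ∧ v ∉ A :=
      ⟨{v | _}, fun v => Iff.rfl⟩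
    have ha : a ∈ A := (hAdef a).2 ⟨Or.inr (Or.inl rfl), SimpleGraph.Walk.nil, by
      simpa using hxa, by simpa using hya⟩
    have hA : ∀ v ∈ A, v ∉ L ∧ v ≠ x ∧ v ≠ y ∧ v ∉ B := by
      intro v hv
      obtain ⟨hvC, p, hpx, hpy⟩ := (hAdef v).1 hv
      refine ⟨?_, ?_, ?_, fun h => ((hBdef v).1 h).2.2.2 hv⟩
      · rcases hvC with h | rfl | rfl
        · exact hCL v h
        · exact D.left_notMem
        · exact D.right_notMem
      · rintro rfl
        exact hpx p.end_mem_support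
      · rintro rfl
        exact hpy p.end_mem_support
    have hB : ∀ v ∈ B, v ∉ L ∧ v ≠ x ∧ v ≠ y ∧ v ∉ A := fun v hv => (hBdef v).1 hv
    have hb : b ∈ B := by
      refine (hBdef b).2 ⟨D.right_notMem, hxb.symm, hyb.symm, fun h => ?_⟩
      obtain ⟨-, p, hpx, hpy⟩ := (hAdef b).1 h
      obtain ⟨t, rfl | rfl, ht⟩ := hwalk p
      · exact hpx ht
      · exact hpy ht
    have hcov : ∀ v, v ∉ L → v = x ∨ v = y ∨ v ∈ A ∨ v ∈ B := by
      intro v hv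
      have := hBdef v
      tauto
    have hcross : ∀ u ∈ A, ∀ v ∈ B, ¬ G.Adj u v := by
      intro u hu v hv huv
      obtain ⟨hvL, hvx, hvy, hvA⟩ := hB v hv
      obtain ⟨huC, p, hpx, hpy⟩ := (hAdef u).1 hu
      have hvC := hcover v hvL
      have hr : (restrictTo G (C ∪ {a, b})).Adj u v := by
        rw [restrictTo, SimpleGraph.fromRel_adj]
        exact ⟨huv.ne, Or.inl ⟨huv, huC, hvC⟩⟩
      refine hvA ((hAdef v).2 ⟨hvC, p.concat hr, ?_, ?_⟩)
      · simp [SimpleGraph.Walk.support_concat, hpx, hvx.symm]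
      · simp [SimpleGraph.Walk.support_concat, hpy, hvy.symm]
    exact D.false_of_avoided_edge hadj (hCL x hx) hxa hxb
      (D.symm.nonplanarOn_delete_cut_edge hadj hxb hxa hyb hya
        (fun v hv => (hcov v hv).imp id (Or.imp id Or.symm)) hB hA hb ha
        (fun u hu v hv huv => hcross v hv u hu huv.symm))
      (D.nonplanarOn_delete_cut_edge hadj hxa hxb hya hyb hcov hA hB ha hb hcross)
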